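/- arXiv:1503.04710 — 5 statements merged into one kernel-verified Lean document; each statement's English description precedes it below -/
import Mathlib

section
/- Let λ0 ≥ λ1 ≥ ... ≥ λM ≥ 0 > λ_{M+1} ≥ ... ≥ λn be real numbers. Suppose there exists a partition Λ1 ∪ Λ2 ∪ ... ∪ ΛS of the multiset {λ_{M+1}, λ_{M+2}, ..., λn} with M > S, such that |Λj| is odd for each j = 1, 2, ..., S, and, setting Tk = Σ_{λ ∈ Λk} λ, one has T_S ≥ T_{S−1} ≥ ... ≥ T_1 and, with K = { i ∈ {1,2,...,S} : λi + Ti < 0 }: (1) λ0 + Σ_{i ∈ K, i < k} (λi + Ti) + Tk ≥ 0 for all k ∈ K, and (2) λ0 + Σ_{i ∈ K} (λi + Ti) ≥ 0. Then there exists an (n+1)×(n+1) nonnegative bisymmetric real matrix whose eigenvalues (with multiplicity) are λ0, λ1, ..., λn. -/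
open Matrix Polynomial BigOperators

/-- The `n × n` reverse identity (exchange) matrix `J`, with entry `1` in
positions `(i, j)` with `i + j = n - 1` (0-based) and `0` elsewhere. -/
def revId (n : ℕ) : Matrix (Fin n) (Fin n) ℝ :=
  Matrix.of fun i j => if (i : ℕ) + (j : ℕ) + 1 = n then 1 else 0

/-- A square real matrix `Q` is bisymmetric if `Qᵀ = Q` and `JQJ = Q`. -/
def IsBisymm {n : ℕ} (Q : Matrix (Fin n) (Fin n) ℝ) : Prop :=
  Qᵀ = Q ∧ revId n * Q * revId n = Q

/-- Entrywise nonnegative matrix. -/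
def MatNonneg {n : ℕ} (Q : Matrix (Fin n) (Fin n) ℝ) : Prop :=
  ∀ i j, 0 ≤ Q i j

/-- Entrywise positive matrix. -/
def MatPos {n : ℕ} (Q : Matrix (Fin n) (Fin n) ℝ) : Prop :=
  ∀ i j, 0 < Q i j

/-- `lam 0, …, lam (n-1)` are the eigenvalues of `Q` with multiplicity, i.e. the
characteristic polynomial of `Q` is `∏ i (X - lam i)`. -/
def HasEigs {n : ℕ} (Q : Matrix (Fin n) (Fin n) ℝ) (lam : Fin n → ℝ) : Prop :=
  Q.charpoly = ∏ i, (X - Polynomial.C (lam i))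

/-- The multiset `μ` is the multiset of eigenvalues (with multiplicity) of `Q`. -/
def HasEigsM {n : ℕ} (Q : Matrix (Fin n) (Fin n) ℝ) (μ : Multiset ℝ) : Prop :=
  Q.charpoly = (μ.map fun a => X - Polynomial.C a).prod

/-- `r` is the Perron root of `Q`: it is a (real) eigenvalue of `Q` which equals the
spectral radius of `Q`, i.e. every complex eigenvalue of `Q` has modulus at most `r`. -/
def IsPerronRoot {n : ℕ} (Q : Matrix (Fin n) (Fin n) ℝ) (r : ℝ) : Prop :=
  r ∈ spectrum ℝ Q ∧ ∀ μ ∈ spectrum ℂ (Q.map fun a => (a : ℂ)), ‖μ‖ ≤ r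

/-- Rank-two (Fiedler type) update of the characteristic polynomial. -/
theorem charpoly_fiedler {m : Type} [Fintype m] [DecidableEq m] (D : Matrix m m ℝ)
    (u v : m → ℝ) (α β ρ : ℝ) (hu : D *ᵥ u = α • u) (hv : D *ᵥ v = β • v)
    (huu : u ⬝ᵥ u = 1) (hvv : v ⬝ᵥ v = 1) (huv : u ⬝ᵥ v = 0) :
    (D + ρ • (vecMulVec u v + vecMulVec v u)).charpoly * ((X - C α) * (X - C β))
      = D.charpoly * ((X - C α) * (X - C β) - C (ρ ^ 2)) := by
  apply Polynomial.eq_of_infinite_eval_eq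
  have hfin : ({α, β} : Set ℝ).Finite := by simp
  refine Set.Infinite.mono ?_ hfin.infinite_compl
  intro x hx
  simp only [Set.mem_compl_iff, Set.mem_insert_iff, Set.mem_singleton_iff, not_or] at hx
  obtain ⟨hxα, hxβ⟩ := hx
  have h1 : x - α ≠ 0 := sub_ne_zero.mpr hxα
  have h2 : x - β ≠ 0 := sub_ne_zero.mpr hxβ
  simp only [Set.mem_ofPred_eq, eval_mul, eval_sub, eval_X, eval_C, Matrix.eval_charpoly]
  let P : Matrix m (Fin 2) ℝ := of fun i k => ![u i, v i] k
  let W : Matrix (Fin 2) m ℝ := of ![fun j => ρ / (x - α) * v j, fun j => ρ / (x - β) * u j]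
  have hPW : P * W = (ρ / (x - α)) • vecMulVec u v + (ρ / (x - β)) • vecMulVec v u := by
    ext i j
    simp [P, W, Matrix.mul_apply, Fin.sum_univ_two, vecMulVec_apply]
    ring
  have hfac : Matrix.scalar m x - (D + ρ • (vecMulVec u v + vecMulVec v u))
      = (Matrix.scalar m x - D) * (1 - P * W) := by
    have e1 : (Matrix.scalar m x - D) * vecMulVec u v = (x - α) • vecMulVec u v := by
      rw [Matrix.mul_vecMulVec, Matrix.sub_mulVec, hu]
      ext i j
      simp [vecMulVec_apply, Matrix.scalar_apply]
      ring
    have e2 : (Matrix.scalar m x - D) * vecMulVec v u = (x - β) • vecMulVec v u := by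
      rw [Matrix.mul_vecMulVec, Matrix.sub_mulVec, hv]
      ext i j
      simp [vecMulVec_apply, Matrix.scalar_apply]
      ring
    rw [mul_sub, mul_one, hPW, mul_add, Matrix.mul_smul, Matrix.mul_smul, e1, e2, smul_smul,
      smul_smul, div_mul_cancel₀ _ h1, div_mul_cancel₀ _ h2, smul_add]
    abel
  have hWP : W * P = !![0, ρ / (x - α); ρ / (x - β), 0] := by
    have hvu : v ⬝ᵥ u = 0 := by rw [dotProduct_comm]; exact huv
    simp only [dotProduct] at huu hvv huv hvu
    ext i j
    fin_cases i <;> fin_cases j <;>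
      simp [P, W, Matrix.mul_apply, mul_assoc, ← Finset.mul_sum, huu, hvv, huv, hvu]
  rw [hfac, det_mul, det_one_sub_mul_comm, hWP, Matrix.det_fin_two]
  simp
  field_simp

/-- Realizability by a symmetric nonnegative matrix which commutes with an involution having
`f` fixed points; `r` is an eigenvalue with an invariant nonnegative unit eigenvector. -/
def Rz (f : ℕ) (r : ℝ) (μ : Multiset ℝ) : Prop :=
  ∃ (ι : Type) (_ : Fintype ι) (_ : DecidableEq ι) (σ : Equiv.Perm ι) (A : Matrix ι ι ℝ)
    (u : ι → ℝ),
    (∀ i, σ (σ i) = i) ∧ (Finset.univ.filter fun i => σ i = i).card = f ∧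
    (∀ i j, A i j = A j i) ∧ (∀ i j, 0 ≤ A i j) ∧ (∀ i j, A (σ i) (σ j) = A i j) ∧
    (∀ i, 0 ≤ u i) ∧ (∀ i, u (σ i) = u i) ∧ u ⬝ᵥ u = 1 ∧ A *ᵥ u = r • u ∧
    A.charpoly = (X - C r) * (μ.map fun a => X - C a).prod

theorem Rz.base1 {a : ℝ} (ha : 0 ≤ a) : Rz 1 a 0 := by
  refine ⟨Unit, inferInstance, inferInstance, 1, of fun _ _ => a, fun _ => 1, ?_⟩
  refine ⟨by simp, by simp, by simp, by simpa using ha, by simp, by simp, by simp,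
    by simp [dotProduct], ?_, ?_⟩
  · ext i; simp [mulVec, dotProduct]
  · simp [Matrix.charpoly, Matrix.det_unique]

theorem Rz.base2 {a b : ℝ} (h1 : b ≤ a) (h2 : -b ≤ a) : Rz 0 a {b} := by
  refine ⟨Fin 2, inferInstance, inferInstance, Equiv.swap 0 1,
    !![(a+b)/2, (a-b)/2; (a-b)/2, (a+b)/2], fun _ => (√2)⁻¹, ?_⟩
  have hs : (√2)⁻¹ * (√2)⁻¹ = (2:ℝ)⁻¹ := by
    rw [← mul_inv, Real.mul_self_sqrt (by norm_num)]
  refine ⟨by simp, by decide, ?_, ?_, ?_, ?_, ?_, ?_, ?_, ?_⟩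
  · intro i j; fin_cases i <;> fin_cases j <;> simp
  · intro i j; fin_cases i <;> fin_cases j <;> simp <;> linarith
  · intro i j; fin_cases i <;> fin_cases j <;> simp
  · intro i; positivity
  · simp
  · simp [dotProduct, hs]
  · ext i; fin_cases i <;> simp [mulVec, dotProduct, Fin.sum_univ_two] <;> ring
  · rw [Matrix.charpoly_fin_two]
    simp [Matrix.trace_fin_two, Matrix.det_fin_two]
    have e2 : (C ((a+b)/2) * C ((a+b)/2) - C ((a-b)/2) * C ((a-b)/2) : ℝ[X]) = C a * C b := by
      rw [← C_mul, ← C_mul, ← C_sub, ← C_mul]; congr 1; ring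
    simp only [← C_add, ← C_mul, ← C_sub] at *
    rw [e2]
    simp only [C_add, C_mul]
    ring

/-- Combination of two realizations. -/
theorem Rz.comb {f g : ℕ} {α β : ℝ} {μ ν : Multiset ℝ} (hA : Rz f α μ) (hB : Rz g β ν)
    (r s ρ a b : ℝ) (hρ : 0 ≤ ρ) (ha : 0 ≤ a) (hb : 0 ≤ b) (hab : a * a + b * b = 1)
    (h1 : α * a + ρ * b = r * a) (h2 : ρ * a + β * b = r * b) (h3 : r + s = α + β)
    (h4 : r * s = α * β - ρ ^ 2) : Rz (f + g) r (s ::ₘ (μ + ν)) := by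
  obtain ⟨ι, _, _, σ, A, u, hσ, hf, hAs, hAn, hAσ, hun, huσ, huu, hAu, hAc⟩ := hA
  obtain ⟨κ, _, _, τ, B, v, hτ, hg, hBs, hBn, hBτ, hvn, hvτ, hvv, hBv, hBc⟩ := hB
  have hblock : fromBlocks A (of fun i j => ρ * (u i * v j)) (of fun i j => ρ * (v i * u j)) B
      = fromBlocks A 0 0 B + ρ • (vecMulVec (Sum.elim u 0) (Sum.elim 0 v)
        + vecMulVec (Sum.elim 0 v) (Sum.elim u 0)) := by
    ext i j
    rcases i with i | i <;> rcases j with j | j <;> simp [vecMulVec_apply]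
  refine ⟨ι ⊕ κ, inferInstance, inferInstance, Equiv.sumCongr σ τ,
    fromBlocks A (of fun i j => ρ * (u i * v j)) (of fun i j => ρ * (v i * u j)) B,
    Sum.elim (fun i => a * u i) (fun j => b * v j), ?_⟩
  refine ⟨?_, ?_, ?_, ?_, ?_, ?_, ?_, ?_, ?_, ?_⟩
  · rintro (i | i) <;> simp [hσ, hτ]
  · rw [Finset.card_filter, Fintype.sum_sum_type, ← hf, ← hg, Finset.card_filter,
      Finset.card_filter]
    simp
  · rintro (i | i) (j | j)
    · simpa using hAs i j
    · simp [mul_comm]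
    · simp [mul_comm]
    · simpa using hBs i j
  · rintro (i | i) (j | j)
    · simpa using hAn i j
    · simpa using mul_nonneg hρ (mul_nonneg (hun i) (hvn j))
    · simpa using mul_nonneg hρ (mul_nonneg (hvn i) (hun j))
    · simpa using hBn i j
  · rintro (i | i) (j | j) <;> simp [hAσ, hBτ, huσ, hvτ]
  · rintro (i | i)
    · simpa using mul_nonneg ha (hun i)
    · simpa using mul_nonneg hb (hvn i)
  · rintro (i | i) <;> simp [huσ, hvτ]
  · simp only [dotProduct, Fintype.sum_sum_type, Sum.elim_inl, Sum.elim_inr] at *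
    simp only [mul_mul_mul_comm a, mul_mul_mul_comm b, ← Finset.mul_sum, huu, hvv]
    linarith
  · have hA' : ∀ i, ∑ j, A i j * u j = α * u i := fun i => by
      simpa [mulVec, dotProduct] using congrFun hAu i
    have hB' : ∀ i, ∑ j, B i j * v j = β * v i := fun i => by
      simpa [mulVec, dotProduct] using congrFun hBv i
    simp only [dotProduct] at huu hvv
    ext i
    rcases i with i | i
    · have e1 : ∑ j, A i j * (a * u j) = a * (α * u i) := by
        rw [← hA', Finset.mul_sum]; exact Finset.sum_congr rfl fun _ _ => by ring
      have e2 : ∑ j, ρ * (u i * v j) * (b * v j) = ρ * b * u i := by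
        rw [← mul_one (ρ * b * u i), ← hvv, Finset.mul_sum]
        exact Finset.sum_congr rfl fun _ _ => by ring
      simp [mulVec, dotProduct, Fintype.sum_sum_type, e1, e2]
      linear_combination u i * h1
    · have e1 : ∑ j, B i j * (b * v j) = b * (β * v i) := by
        rw [← hB', Finset.mul_sum]; exact Finset.sum_congr rfl fun _ _ => by ring
      have e2 : ∑ j, ρ * (v i * u j) * (a * u j) = ρ * a * v i := by
        rw [← mul_one (ρ * a * v i), ← huu, Finset.mul_sum]
        exact Finset.sum_congr rfl fun _ _ => by ring
      simp [mulVec, dotProduct, Fintype.sum_sum_type, e1, e2]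
      linear_combination v i * h2
  · have key := charpoly_fiedler (fromBlocks A 0 0 B) (Sum.elim u 0) (Sum.elim 0 v) α β ρ
      (by
        ext i
        rcases i with i | i
        · simpa [fromBlocks_mulVec] using congrFun hAu i
        · simp [fromBlocks_mulVec])
      (by
        ext i
        rcases i with i | i
        · simp [fromBlocks_mulVec]
        · simpa [fromBlocks_mulVec] using congrFun hBv i)
      (by simpa [dotProduct] using huu)
      (by simpa [dotProduct] using hvv)
      (by simp [dotProduct])
    rw [hblock]
    have hne : ((X - C α) * (X - C β) : ℝ[X]) ≠ 0 :=
      mul_ne_zero (X_sub_C_ne_zero _) (X_sub_C_ne_zero _)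
    apply mul_right_cancel₀ hne
    rw [key, Matrix.charpoly_fromBlocks_zero₂₁, hAc, hBc]
    have q : ((X - C α) * (X - C β) - C (ρ ^ 2) : ℝ[X]) = (X - C r) * (X - C s) := by
      have e3 : (C r + C s : ℝ[X]) = C α + C β := by rw [← C_add, ← C_add, h3]
      have e4 : (C r * C s : ℝ[X]) = C α * C β - C (ρ ^ 2) := by
        rw [← C_mul, h4, C_sub, C_mul]
      linear_combination X * e3 - e4
    rw [q]
    simp
    ring

theorem Rz.dsum {f g : ℕ} {r s : ℝ} {μ ν : Multiset ℝ} (hA : Rz f r μ) (hB : Rz g s ν) :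
    Rz (f + g) r (s ::ₘ (μ + ν)) :=
  hA.comb hB r s 0 1 0 le_rfl zero_le_one le_rfl (by ring) (by ring) (by ring) (by ring)
    (by ring)

theorem Rz.join {f g : ℕ} {α β : ℝ} {μ ν : Multiset ℝ} (hA : Rz f α μ) (hB : Rz g β ν)
    (r s : ℝ) (h1 : α < r) (h2 : β ≤ r) (h3 : r + s = α + β) :
    Rz (f + g) r (s ::ₘ (μ + ν)) := by
  have hnn : 0 ≤ (r - α) * (r - β) := mul_nonneg (by linarith) (by linarith)
  set ρ := √((r - α) * (r - β)) with hρ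
  have hρ2 : ρ ^ 2 = (r - α) * (r - β) := Real.sq_sqrt hnn
  have hρ0 : 0 ≤ ρ := Real.sqrt_nonneg _
  have hpos : 0 < ρ ^ 2 + (r - α) ^ 2 := by
    have : 0 < r - α := by linarith
    positivity
  set N := √(ρ ^ 2 + (r - α) ^ 2) with hN
  have hN2 : N ^ 2 = ρ ^ 2 + (r - α) ^ 2 := Real.sq_sqrt hpos.le
  have hN0 : 0 < N := Real.sqrt_pos.mpr hpos
  refine hA.comb hB r s ρ (ρ / N) ((r - α) / N) hρ0 (by positivity)
    (div_nonneg (by linarith) hN0.le) ?_ ?_ ?_ h3 ?_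
  · field_simp; linarith
  · field_simp; ring
  · field_simp; linear_combination hρ2
  · rw [hρ2]; linear_combination r * h3

theorem Rz.group : ∀ (m : ℕ) (L : Multiset ℝ) (r : ℝ), Multiset.card L = 2 * m + 1 →
    (∀ x ∈ L, x < 0) → -L.sum ≤ r → Rz 0 r L := by
  intro m
  induction m with
  | zero =>
    intro L r hc hL hr
    obtain ⟨x, rfl⟩ := Multiset.card_eq_one.mp (by simpa using hc)
    simp at hL hr
    exact Rz.base2 (by linarith) (by linarith)
  | succ m ih =>
    intro L r hc hL hr
    obtain ⟨x, L1, rfl⟩ : ∃ x L1, L = x ::ₘ L1 := by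
      obtain ⟨x, hx⟩ := Multiset.card_pos_iff_exists_mem.mp (by omega : 0 < Multiset.card L)
      exact ⟨x, Multiset.exists_cons_of_mem hx⟩
    obtain ⟨y, L2, rfl⟩ : ∃ y L2, L1 = y ::ₘ L2 := by
      obtain ⟨x, hx⟩ := Multiset.card_pos_iff_exists_mem.mp
        (by simp at hc; omega : 0 < Multiset.card L1)
      exact ⟨x, Multiset.exists_cons_of_mem hx⟩
    simp only [Multiset.card_cons, Multiset.sum_cons] at hc hr
    have hx : x < 0 := hL x (by simp)
    have hy : y < 0 := hL y (by simp)
    have hL2 : ∀ z ∈ L2, z < 0 := fun z hz => hL z (by simp [hz])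
    have hsum : L2.sum ≤ 0 := by
      have := Multiset.sum_nonneg (s := L2.map (fun z => -z)) (by
        intro z hz
        obtain ⟨w, hw, rfl⟩ := Multiset.mem_map.mp hz
        linarith [hL2 w hw])
      rw [Multiset.sum_map_neg] at this
      simpa using this
    have h0 := ih L2 (r + x + y) (by omega) hL2 (by linarith)
    have hb : Rz 0 (-x) {x} := Rz.base2 (by linarith) (by linarith)
    have := h0.join hb r y (by linarith) (by linarith) (by ring)
    have e : x ::ₘ y ::ₘ L2 = y ::ₘ (L2 + {x}) := by
      rw [Multiset.cons_swap, add_comm, Multiset.singleton_add]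
    rw [e]; exact this

theorem cycleType_invol {N : ℕ} (σ : Equiv.Perm (Fin N)) (h : ∀ i, σ (σ i) = i)
    (hf : (Finset.univ.filter fun i => σ i = i).card ≤ 1) :
    σ.cycleType = Multiset.replicate (N / 2) 2 := by
  have : Fact (Nat.Prime 2) := ⟨Nat.prime_two⟩
  have h2 : σ ^ 2 = 1 := by
    ext i; simp [pow_two, h]
  have h3 := Equiv.Perm.cycleType_of_pow_prime_eq_one h2
  have h4 := σ.sum_cycleType
  rw [h3, Multiset.sum_replicate] at h4
  have h5 : (Finset.univ.filter fun i => σ i = i).card + σ.support.card = N := by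
    have := Finset.card_filter_add_card_filter_not (s := (Finset.univ : Finset (Fin N)))
      (fun i => σ i = i)
    rw [Finset.card_univ, Fintype.card_fin] at this
    have e : σ.support = Finset.univ.filter fun i => ¬ σ i = i := by
      ext i; simp
    rw [e]; exact this
  rw [h3]
  congr 1
  rw [smul_eq_mul] at h4
  omega

theorem revId_apply' {N : ℕ} (i j : Fin N) : revId N i j = if j = Fin.rev i then 1 else 0 := by
  have : (i : ℕ) + (j : ℕ) + 1 = N ↔ j = Fin.rev i := by
    rw [Fin.ext_iff, Fin.val_rev]; omega
  simp [revId, this]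

theorem Rz.final {f : ℕ} {r : ℝ} {μ : Multiset ℝ} (h : Rz f r μ) (hf : f ≤ 1) (N : ℕ)
    (hN : Multiset.card μ + 1 = N) :
    ∃ Q : Matrix (Fin N) (Fin N) ℝ, MatNonneg Q ∧ IsBisymm Q ∧
      Q.charpoly = ((r ::ₘ μ).map fun a => X - C a).prod := by
  obtain ⟨ι, _, _, σ, A, u, hσ, hfix, hAs, hAn, hAσ, hun, huσ, huu, hAu, hAc⟩ := h
  have hc' : A.charpoly = ((r ::ₘ μ).map fun a => X - C a).prod := by
    rw [hAc]; simp
  have hcard : Fintype.card ι = N := by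
    rw [← Matrix.charpoly_natDegree_eq_dim A, hc', Polynomial.natDegree_multiset_prod_X_sub_C_eq_card]
    simpa using hN
  let e0 : ι ≃ Fin N := Fintype.equivFinOfCardEq hcard
  let τ : Equiv.Perm (Fin N) := (e0.symm.trans σ).trans e0
  have hτ : τ.cycleType = Multiset.replicate (N / 2) 2 := by
    apply cycleType_invol
    · intro i; simp [τ, hσ]
    · refine le_trans (le_of_eq ?_) hf
      rw [← hfix]
      refine Finset.card_bij (fun i _ => e0.symm i) ?_ ?_ ?_
      · intro i hi
        have hi2 : e0 (σ (e0.symm i)) = i := (Finset.mem_filter.mp hi).2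
        refine Finset.mem_filter.mpr ⟨Finset.mem_univ _, ?_⟩
        exact e0.injective (by simpa using hi2)
      · intro i _ j _ hij; exact e0.symm.injective hij
      · intro i hi
        refine ⟨e0 i, ?_, by simp⟩
        have hi2 : σ i = i := (Finset.mem_filter.mp hi).2
        refine Finset.mem_filter.mpr ⟨Finset.mem_univ _, ?_⟩
        simp [τ, hi2]
  have hr : (Fin.revPerm : Equiv.Perm (Fin N)).cycleType = Multiset.replicate (N / 2) 2 := by
    apply cycleType_invol
    · intro i; simp
    · rw [Finset.card_le_one]
      intro a ha b hb
      simp only [Finset.mem_filter, Finset.mem_univ, true_and, Fin.revPerm_apply, Fin.ext_iff,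
        Fin.val_rev] at ha hb
      rw [Fin.ext_iff]; omega
  obtain ⟨c, hc⟩ := isConj_iff.mp (Equiv.Perm.isConj_iff_cycleType_eq.mpr (hτ.trans hr.symm))
  let e : ι ≃ Fin N := e0.trans c
  have he : ∀ i, e.symm (Fin.rev i) = σ (e.symm i) := by
    intro i
    have := congrArg (fun p : Equiv.Perm (Fin N) => p i) hc
    simp only [Equiv.Perm.mul_apply, Fin.revPerm_apply] at this
    rw [← this]
    simp [e, τ]
  refine ⟨Matrix.reindex e e A, ?_, ⟨?_, ?_⟩, ?_⟩
  · intro i j; exact hAn _ _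
  · ext i j; exact hAs _ _
  · ext i j
    have e2 : ∀ k, revId N k j = if k = Fin.rev j then 1 else 0 := by
      intro k
      rw [revId_apply']
      congr 1
      exact propext ⟨fun h => by rw [h, Fin.rev_rev], fun h => by rw [h, Fin.rev_rev]⟩
    simp [Matrix.mul_apply, e2, revId_apply', he, hAσ]
  · rw [Matrix.charpoly_reindex, hc']

theorem Rz.pairs {f : ℕ} {r : ℝ} {μ : Multiset ℝ} (h : Rz f r μ) (lam : ℕ → ℝ) (s d : ℕ)
    (hl : ∀ i j, i ≤ j → j < s + 2 * d → lam j ≤ lam i)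
    (h0 : ∀ i, i < s + 2 * d → 0 ≤ lam i) :
    Rz f r (μ + (Finset.Ico s (s + 2 * d)).val.map lam) := by
  induction d with
  | zero => simpa using h
  | succ d ih =>
    have h1 := ih (fun i j hij hj => hl i j hij (by omega)) (fun i hi => h0 i (by omega))
    have ha := h0 (s + 2 * d) (by omega)
    have hb := h0 (s + 2 * d + 1) (by omega)
    have hab := hl (s + 2 * d) (s + 2 * d + 1) (by omega) (by omega)
    have h2 := h1.dsum (Rz.base2 (a := lam (s + 2 * d)) (b := lam (s + 2 * d + 1)) hab
      (by linarith))
    have e : Finset.Ico s (s + 2 * (d + 1))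
        = insert (s + 2 * d) (insert (s + 2 * d + 1) (Finset.Ico s (s + 2 * d))) := by
      ext j; simp; omega
    rw [e, Finset.insert_val_of_notMem (by simp), Finset.insert_val_of_notMem (by simp),
      Multiset.map_cons, Multiset.map_cons]
    rw [add_zero] at h2
    convert h2 using 1
    simp only [← Multiset.singleton_add]
    abel

/-- Borobia-type condition for the BNIEP, case `M > S` (Theorem 3.5): with a partition
`Λ₁ ∪ … ∪ Λ_S` of the negative part into parts of odd size, part sums `T_S ≥ … ≥ T₁`, and
Kellogg-type inequalities, the list `λ₀, …, λₙ` is realizable by a nonnegative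
bisymmetric matrix. (Here `Λ j`, `T j`, `j : Fin S`, represent `Λ_{j+1}`, `T_{j+1}`.) -/
theorem bniep_borobia_M_gt_S (n M S : ℕ) (hMn : M ≤ n) (hSM : S < M)
    (lam : ℕ → ℝ)
    (hanti : ∀ i j, i ≤ j → j ≤ n → lam j ≤ lam i)
    (hM0 : 0 ≤ lam M)
    (hneg : ∀ i, M < i → i ≤ n → lam i < 0)
    (Λ : Fin S → Multiset ℝ)
    (hpart : (∑ j, Λ j) = (Finset.Icc (M + 1) n).val.map lam)
    (hodd : ∀ j : Fin S, Odd (Multiset.card (Λ j)))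
    (T : Fin S → ℝ) (hT : ∀ j, T j = (Λ j).sum)
    (hTmono : Monotone T)
    (K : Finset (Fin S))
    (hK : K = Finset.univ.filter fun i : Fin S => lam ((i : ℕ) + 1) + T i < 0)
    (h1 : ∀ k ∈ K,
      0 ≤ lam 0 + (∑ i ∈ K.filter fun i => i < k, (lam ((i : ℕ) + 1) + T i)) + T k)
    (h2 : 0 ≤ lam 0 + ∑ i ∈ K, (lam ((i : ℕ) + 1) + T i)) :
    ∃ Q : Matrix (Fin (n + 1)) (Fin (n + 1)) ℝ,
      MatNonneg Q ∧ IsBisymm Q ∧ HasEigs Q fun i => lam (i : ℕ) := by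
  -- extend the data to all natural indices
  let L : ℕ → Multiset ℝ := fun i => if h : i < S then Λ ⟨i, h⟩ else 0
  let δ : ℕ → ℝ := fun i => if lam (i + 1) + (L i).sum < 0 then lam (i + 1) + (L i).sum else 0
  let al : ℕ → ℝ := fun k => lam 0 + ∑ i ∈ Finset.range k, δ i
  have hLfin : ∀ j : Fin S, L j = Λ j := fun j => by simp [L]
  have hLsum : ∑ i ∈ Finset.range S, L i = (Finset.Icc (M + 1) n).val.map lam := by
    rw [← hpart, ← Fin.sum_univ_eq_sum_range]
    exact Finset.sum_congr rfl fun j _ => hLfin j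
  have hLneg : ∀ i < S, ∀ x ∈ L i, x < 0 := by
    intro i hi x hx
    have : x ∈ ∑ i ∈ Finset.range S, L i :=
      Multiset.mem_sum.mpr ⟨i, Finset.mem_range.mpr hi, hx⟩
    rw [hLsum] at this
    obtain ⟨k, hk, rfl⟩ := Multiset.mem_map.mp this
    have hk' : k ∈ Finset.Icc (M + 1) n := hk
    rw [Finset.mem_Icc] at hk'
    exact hneg k (by omega) hk'.2
  have hLodd : ∀ i < S, Odd (Multiset.card (L i)) := by
    intro i hi
    simpa [L, hi] using hodd ⟨i, hi⟩
  have hcond : ∀ i < S, lam (i + 1) + (L i).sum < 0 → 0 ≤ al i + (L i).sum := by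
    intro i hi hlt
    have hLi : (L i).sum = T ⟨i, hi⟩ := by rw [hT]; simp [L, hi]
    have hmem : (⟨i, hi⟩ : Fin S) ∈ K := by
      rw [hK]; simp [← hLi, hlt]
    have := h1 _ hmem
    have e : ∑ j ∈ K.filter fun j => j < ⟨i, hi⟩, (lam ((j : ℕ) + 1) + T j)
        = ∑ j ∈ Finset.range i, δ j := by
      have e1 : Finset.range i = (Finset.range S).filter fun j => j < i := by
        ext j; simp; omega
      rw [e1, Finset.sum_filter (s := Finset.range S), ← Fin.sum_univ_eq_sum_range (fun j => if j < i then δ j else 0),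
        hK, Finset.filter_filter, Finset.sum_filter]
      refine Finset.sum_congr rfl fun j _ => ?_
      simp only [δ, hLfin, ← hT, Fin.lt_def]
      by_cases ha : lam ((j : ℕ) + 1) + T j < 0 <;> by_cases hb : (j : ℕ) < i <;>
        simp [ha, hb]
    rw [e] at this
    rw [hLi]
    exact this
  -- all the intermediate Perron roots dominate `lam M`
  have hal : ∀ k ≤ S, lam M ≤ al k := by
    intro k
    induction k with
    | zero => intro _; simpa [al] using hanti 0 M (by omega) hMn
    | succ k ih =>
      intro hk
      have h3 := ih (by omega)
      have e : al (k + 1) = al k + δ k := by simp [al, Finset.sum_range_succ, add_assoc]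
      rw [e]
      by_cases hlt : lam (k + 1) + (L k).sum < 0
      · have := hcond k (by omega) hlt
        have h4 := hanti (k + 1) M (by omega) hMn
        simp only [δ, if_pos hlt]
        linarith
      · simp only [δ, if_neg hlt]; linarith
  have hnn : ∀ i ≤ M, 0 ≤ lam i := fun i hi => hM0.trans (hanti i M hi hMn)
  -- the core
  have hbase : ∃ f ≤ 1, Rz f (al S) ((Finset.Ico (S + 1) (M + 1)).val.map lam) := by
    obtain ⟨d, hd | hd⟩ : ∃ d, M = S + 2 * d ∨ M = S + 2 * d + 1 := ⟨(M - S) / 2, by omega⟩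
    · refine ⟨1, le_rfl, ?_⟩
      have := (Rz.base1 (hM0.trans (hal S le_rfl))).pairs lam (S + 1) d
        (fun i j hij hj => hanti i j hij (by omega)) (fun i hi => hnn i (by omega))
      rw [zero_add] at this
      have e : M + 1 = S + 1 + 2 * d := by omega
      rw [e]; exact this
    · refine ⟨0, zero_le_one, ?_⟩
      have h3 := hal S le_rfl
      have := (Rz.base2 (a := al S) (b := lam M) h3 (by linarith)).pairs lam (S + 1) d
        (fun i j hij hj => hanti i j hij (by omega)) (fun i hi => hnn i (by omega))
      have e : S + 1 + 2 * d = M := by omega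
      rw [e, Multiset.singleton_add] at this
      have e2 : Finset.Ico (S + 1) (M + 1) = insert M (Finset.Ico (S + 1) M) := by
        ext j; simp; omega
      rw [e2, Finset.insert_val_of_notMem (by simp), Multiset.map_cons]
      exact this
  obtain ⟨f, hf, hbase⟩ := hbase
  -- add the groups one at a time
  have hstep : ∀ k ≤ S, Rz f (al (S - k)) ((Finset.Ico (S + 1) (M + 1)).val.map lam
      + ∑ i ∈ Finset.Ico (S - k) S, (lam (i + 1) ::ₘ L i)) := by
    intro k
    induction k with
    | zero => intro _; simpa using hbase
    | succ k ih =>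
      intro hk
      have h3 := ih (by omega)
      obtain ⟨i, hi⟩ : ∃ i, i = S - (k + 1) := ⟨_, rfl⟩
      have hi' : S - k = i + 1 := by omega
      have hiS : i < S := by omega
      rw [← hi]
      rw [hi'] at h3
      rw [Finset.sum_eq_sum_Ico_succ_bot hiS]
      obtain ⟨m, hm⟩ := hLodd i hiS
      have e : al (i + 1) = al i + δ i := by simp [al, Finset.sum_range_succ, add_assoc]
      have goalrw : ∀ Z W : Multiset ℝ, Z + (lam (i + 1) ::ₘ L i + W)
          = lam (i + 1) ::ₘ ((Z + W) + L i) := by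
        intro Z W
        simp only [← Multiset.singleton_add]
        abel
      rw [goalrw]
      by_cases hlt : lam (i + 1) + (L i).sum < 0
      · have hc := hcond i hiS hlt
        have hg := Rz.group m (L i) (-(L i).sum) hm (hLneg i hiS) le_rfl
        have e2 : al (i + 1) = al i + (lam (i + 1) + (L i).sum) := by
          rw [e]; simp only [δ, if_pos hlt]
        exact h3.join hg (al i) (lam (i + 1)) (by linarith) (by linarith) (by linarith)
      · have hg := Rz.group m (L i) (lam (i + 1)) hm (hLneg i hiS) (by linarith)
        have e2 : al (i + 1) = al i := by
          rw [e]; simp only [δ, if_neg hlt]; ring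
        rw [e2] at h3
        exact h3.dsum hg
  have hfin := hstep S le_rfl
  rw [Nat.sub_self] at hfin
  have ht : (al 0 ::ₘ ((Finset.Ico (S + 1) (M + 1)).val.map lam
      + ∑ i ∈ Finset.Ico 0 S, (lam (i + 1) ::ₘ L i)))
      = (Finset.range (n + 1)).val.map lam := by
    have a0 : al 0 = lam 0 := by simp [al]
    have a1 : ∑ i ∈ Finset.Ico 0 S, (lam (i + 1) ::ₘ L i)
        = (Finset.Ico 1 (S + 1)).val.map lam + (Finset.Ico (M + 1) (n + 1)).val.map lam := by
      have b1 : ∑ i ∈ Finset.range S, ({lam (i + 1)} : Multiset ℝ)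
          = (Finset.Ico 1 (S + 1)).val.map lam := by
        have b3 : ∀ q : ℕ, ∑ i ∈ Finset.range q, ({lam (i + 1)} : Multiset ℝ)
            = (Finset.Ico 1 (q + 1)).val.map lam := by
          intro q
          induction q with
          | zero => simp
          | succ q ih =>
            have e : Finset.Ico 1 (q + 1 + 1) = insert (q + 1) (Finset.Ico 1 (q + 1)) := by
              ext j; simp only [Finset.mem_insert, Finset.mem_Ico]; omega
            rw [Finset.sum_range_succ, ih, e, Finset.insert_val_of_notMem (by simp),
              Multiset.map_cons, add_comm, Multiset.singleton_add]
        exact b3 S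
      have b2 : Finset.Ico (M + 1) (n + 1) = Finset.Icc (M + 1) n := by
        ext j; simp only [Finset.mem_Ico, Finset.mem_Icc]; omega
      rw [b2, ← hLsum, ← b1, ← Finset.sum_add_distrib, Nat.Ico_zero_eq_range]
      simp [Multiset.singleton_add]
    have hI : ∀ a b c : ℕ, a ≤ b → b ≤ c → (Finset.Ico a c).val.map lam
        = (Finset.Ico a b).val.map lam + (Finset.Ico b c).val.map lam := by
      intro a b c hab hbc
      rw [← Multiset.map_add, ← Finset.Ico_union_Ico_eq_Ico hab hbc,
        ← Finset.disjUnion_eq_union _ _ (Finset.Ico_disjoint_Ico_consecutive a b c)]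
      rfl
    rw [a0, a1, ← Nat.Ico_zero_eq_range, hI 0 1 (n + 1) (by omega) (by omega),
      hI 1 (S + 1) (n + 1) (by omega) (by omega), hI (S + 1) (M + 1) (n + 1) (by omega) (by omega)]
    have : (Finset.Ico 0 1).val.map lam = {lam 0} := rfl
    rw [this, ← Multiset.singleton_add]
    abel
  obtain ⟨Q, hQ1, hQ2, hQ3⟩ := hfin.final hf (n + 1) (by
    have := congrArg Multiset.card ht
    simpa using this)
  refine ⟨Q, hQ1, hQ2, ?_⟩
  rw [HasEigs, hQ3, ht, Fin.prod_univ_eq_prod_range (fun i => (X - C (lam i) : ℝ[X])) (n + 1),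
    Multiset.map_map]
  rfl
end

section
/- Let λ1 ≥ λ2 ≥ ... ≥ λn be real numbers, let S ≤ n, and let ω1, ..., ωS be real numbers with 0 ≤ ωk ≤ λ1 for k = 1, ..., S. Suppose that: (1) there is a partition Λ1 ∪ ... ∪ ΛS of the multiset {λ1, ..., λn}, at most one of the parts Λi having odd size, where Λj = {λ_{j1}, λ_{j2}, ..., λ_{j p_j}} with λ_{jk} ≥ λ_{j(k+1)}, λ_{j1} ≥ 0, and λ_{11} = λ1, such that for each j = 1, ..., S the multiset Γj = {ωj, λ_{j2}, ..., λ_{j p_j}} is the multiset of eigenvalues of some p_j × p_j nonnegative bisymmetric real matrix whose Perron root is ωj; and (2) there is an S×S nonnegative symmetric real matrix B whose eigenvalues (with multiplicity) are λ_{11}, λ_{21}, ..., λ_{S1} and whose diagonal entries are ω1, ω2, ..., ωS. Then there exists an n×n nonnegative bisymmetric real matrix whose eigenvalues (with multiplicity) are λ1, λ2, ..., λn. -/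
open Matrix Polynomial BigOperators

lemma aux_revId (n : ℕ) : revId n = (1 : Matrix (Fin n) (Fin n) ℝ).submatrix Fin.rev id := by
  ext i j
  simp only [revId, Matrix.of_apply, Matrix.submatrix_apply, Matrix.one_apply, id]
  congr 1
  rw [eq_iff_iff, Fin.ext_iff, Fin.val_rev]
  omega

lemma aux_revId_conj (n : ℕ) (Q : Matrix (Fin n) (Fin n) ℝ) :
    revId n * Q * revId n = Q.submatrix Fin.rev Fin.rev := by
  have h2 : revId n = (1 : Matrix (Fin n) (Fin n) ℝ).submatrix id Fin.rev := by
    rw [aux_revId]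
    ext i j
    simp [Matrix.one_apply, Fin.rev_eq_iff]
  have h3 : revId n * Q = Q.submatrix Fin.rev id := by
    rw [aux_revId]
    ext i j
    simp [Matrix.mul_apply, Matrix.one_apply]
  rw [h3, h2]
  ext i j
  simp [Matrix.mul_apply, Matrix.one_apply]

/-- A symmetric nonnegative matrix has a nonnegative eigenvector for its Perron root. -/
lemma aux_perron {n : ℕ} (A : Matrix (Fin n) (Fin n) ℝ) (r : ℝ) (hA : MatNonneg A)
    (hs : Aᵀ = A) (hr : IsPerronRoot A r) :
    ∃ x : Fin n → ℝ, x ≠ 0 ∧ (∀ i, 0 ≤ x i) ∧ A *ᵥ x = r • x := by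
  obtain ⟨hr1, hr2⟩ := hr
  have hpsd : (algebraMap ℝ (Matrix (Fin n) (Fin n) ℝ) r - A).PosSemidef := by
    rw [Matrix.posSemidef_iff_isHermitian_and_spectrum_nonneg]
    refine ⟨?_, ?_⟩
    · rw [Matrix.IsHermitian, Matrix.conjTranspose_eq_transpose_of_trivial, Matrix.transpose_sub, hs,
        Matrix.algebraMap_eq_diagonal, Matrix.diagonal_transpose]
    · intro t ht
      rw [← spectrum.singleton_sub_eq] at ht
      obtain ⟨u, hu, s, hs', rfl⟩ := ht
      rw [Set.mem_singleton_iff] at hu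
      subst hu
      have h1 : (s : ℂ) ∈ spectrum ℂ (A.map fun a => (a : ℂ)) := by
        rw [Matrix.mem_spectrum_iff_isRoot_charpoly] at hs' ⊢
        have := Matrix.charpoly_map A Complex.ofRealHom
        have h3 : (A.map fun a => (a : ℂ)) = A.map Complex.ofRealHom := rfl
        rw [h3, this]
        exact hs'.map (f := Complex.ofRealHom)
      have h2 := hr2 _ h1
      rw [Complex.norm_real] at h2
      have := le_abs_self s
      rw [Real.norm_eq_abs] at h2
      show 0 ≤ u - s
      linarith
  have hdet : (algebraMap ℝ (Matrix (Fin n) (Fin n) ℝ) r - A).det = 0 := by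
    rw [spectrum.mem_iff, Matrix.isUnit_iff_isUnit_det, isUnit_iff_ne_zero, not_not] at hr1
    exact hr1
  obtain ⟨v, hv0, hv⟩ := Matrix.exists_mulVec_eq_zero_iff.2 hdet
  have key : ∀ w : Fin n → ℝ, (algebraMap ℝ (Matrix (Fin n) (Fin n) ℝ) r - A) *ᵥ w
      = r • w - A *ᵥ w := by
    intro w
    rw [Matrix.sub_mulVec, Algebra.algebraMap_eq_smul_one, Matrix.smul_mulVec, Matrix.one_mulVec]
  refine ⟨fun i => |v i|, ?_, fun i => abs_nonneg _, ?_⟩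
  · intro h
    apply hv0
    ext i
    simpa using congrFun h i
  · have h0 : (algebraMap ℝ (Matrix (Fin n) (Fin n) ℝ) r - A) *ᵥ (fun i => |v i|) = 0 := by
      rw [← hpsd.dotProduct_mulVec_zero_iff]
      apply le_antisymm _ (hpsd.dotProduct_mulVec_nonneg _)
      have e1 : star v ⬝ᵥ ((algebraMap ℝ (Matrix (Fin n) (Fin n) ℝ) r - A) *ᵥ v) = 0 := by
        rw [hv, dotProduct_zero]
      rw [← e1, key, key]
      simp only [dotProduct, Matrix.mulVec, star_trivial, Pi.sub_apply, Pi.smul_apply, smul_eq_mul,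
        Finset.mul_sum, mul_sub]
      rw [Finset.sum_sub_distrib, Finset.sum_sub_distrib]
      apply sub_le_sub
      · apply le_of_eq
        refine Finset.sum_congr rfl fun i _ => ?_
        have := abs_mul_abs_self (v i)
        linear_combination r * this
      · refine Finset.sum_le_sum fun i _ => Finset.sum_le_sum fun j _ => ?_
        have h1 : v i * v j ≤ |v i| * |v j| := by
          rw [← abs_mul]; exact le_abs_self _
        have := mul_le_mul_of_nonneg_left h1 (hA i j)
        linarith
    rw [key, sub_eq_zero] at h0
    exact h0.symm

/-- Normalised and reversal-invariant Perron vector. -/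
lemma aux_perron_sym {n : ℕ} (A : Matrix (Fin n) (Fin n) ℝ) (r : ℝ) (hA : MatNonneg A)
    (hs : IsBisymm A) (hr : IsPerronRoot A r) :
    ∃ x : Fin n → ℝ, x ⬝ᵥ x = 1 ∧ (∀ i, 0 ≤ x i) ∧ (∀ i, x i.rev = x i) ∧ A *ᵥ x = r • x := by
  obtain ⟨x, hx0, hxn, hx⟩ := aux_perron A r hA hs.1 hr
  have hrev : ∀ i j, A i.rev j.rev = A i j := by
    intro i j
    have := hs.2
    rw [aux_revId_conj] at this
    exact congrFun (congrFun this i) j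
  have hxr : A *ᵥ (fun i => x i.rev) = r • fun i => x i.rev := by
    ext i
    have := congrFun hx i.rev
    simp only [Matrix.mulVec, dotProduct, Pi.smul_apply] at this ⊢
    rw [← this, ← Equiv.sum_comp Fin.revPerm]
    refine Finset.sum_congr rfl fun j _ => ?_
    have h := hrev i j.rev
    rw [Fin.rev_rev] at h
    simp [h]
  set y : Fin n → ℝ := fun i => x i + x i.rev with hy
  have hyA : A *ᵥ y = r • y := by
    have : y = x + fun i => x i.rev := rfl
    rw [this, Matrix.mulVec_add, hx, hxr, smul_add]
  have hy0 : 0 < y ⬝ᵥ y := by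
    obtain ⟨i, hi⟩ := Function.ne_iff.1 hx0
    refine Finset.sum_pos' (fun i _ => mul_self_nonneg _) ⟨i, Finset.mem_univ _, ?_⟩
    have h1 : 0 < x i := lt_of_le_of_ne (hxn i) (Ne.symm hi)
    have h2 : 0 < y i := add_pos_of_pos_of_nonneg h1 (hxn _)
    positivity
  have hc := Real.sqrt_pos.2 hy0
  have hcc := Real.mul_self_sqrt hy0.le
  refine ⟨(Real.sqrt (y ⬝ᵥ y))⁻¹ • y, ?_, ?_, ?_, ?_⟩
  · rw [smul_dotProduct, dotProduct_smul, smul_eq_mul, smul_eq_mul]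
    nth_rewrite 3 [← hcc]
    field_simp
  · intro i
    have := add_nonneg (hxn i) (hxn i.rev)
    simp only [Pi.smul_apply, smul_eq_mul, hy]
    positivity
  · intro i
    simp [hy, add_comm]
  · rw [Matrix.mulVec_smul, hyA, smul_comm]

lemma aux_rado {N S : Type*} [Fintype N] [DecidableEq N] [Fintype S] [DecidableEq S]
    (A : Matrix N N ℝ) (V : Matrix N S ℝ) (Ω K : Matrix S S ℝ)
    (h1 : A * V = V * Ω) (h2 : Vᵀ * A = Ω * Vᵀ) (h3 : Vᵀ * V = 1) :
    Ω.charpoly * (A + V * K * Vᵀ).charpoly = A.charpoly * (Ω + K).charpoly := by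
  set V' : Matrix N S ℝ[X] := V.map C with hV
  set W : Matrix S N ℝ[X] := Vᵀ.map C with hW
  set K' : Matrix S S ℝ[X] := K.map C with hK
  set P := charmatrix A with hP
  set D := charmatrix Ω with hD
  have e1 : P * V' = V' * D := by
    rw [hP, hD, charmatrix, charmatrix, Matrix.sub_mul, Matrix.mul_sub]
    congr 1
    · exact Matrix.scalar_comm _ (fun _ => Commute.all _ _) _
    · simp only [RingHom.mapMatrix_apply]
      rw [hV, ← Matrix.map_mul, h1, Matrix.map_mul]
  have e2 : W * P = D * W := by
    rw [hP, hD, charmatrix, charmatrix, Matrix.sub_mul, Matrix.mul_sub]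
    congr 1
    · exact (Matrix.scalar_comm _ (fun _ => Commute.all _ _) _).symm
    · simp only [RingHom.mapMatrix_apply]
      rw [hW, ← Matrix.map_mul, h2, Matrix.map_mul]
  have e3 : W * V' = 1 := by
    rw [hW, hV, ← Matrix.map_mul, h3, Matrix.map_one _ (map_zero _) (map_one _)]
  have e4 : charmatrix (A + V * K * Vᵀ) = P - V' * K' * W := by
    rw [hP, charmatrix, charmatrix, map_add, sub_add_eq_sub_sub]
    congr 1
    simp only [RingHom.mapMatrix_apply, Matrix.map_mul]
    rfl
  have e5 : charmatrix (Ω + K) = D - K' := by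
    rw [hD, charmatrix, charmatrix, map_add, sub_add_eq_sub_sub]
    rfl
  have key : (1 + V' * ((D - 1) * W)) * (P - V' * K' * W) = P * (1 + V' * ((D - K' - 1) * W)) := by
    have a1 : V' * ((D - 1) * W) * P = V' * ((D - 1) * (D * W)) := by
      rw [Matrix.mul_assoc, Matrix.mul_assoc, e2]
    have a2 : V' * ((D - 1) * W) * (V' * K' * W) = V' * ((D - 1) * (K' * W)) := by
      simp only [Matrix.mul_assoc]
      rw [← Matrix.mul_assoc W, e3, Matrix.one_mul]
    have a3 : P * (V' * ((D - K' - 1) * W)) = V' * (D * ((D - K' - 1) * W)) := by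
      rw [← Matrix.mul_assoc, e1, Matrix.mul_assoc]
    rw [add_mul, Matrix.one_mul, mul_sub, mul_add, Matrix.mul_one, a1, a2, a3]
    simp only [Matrix.sub_mul, Matrix.mul_sub, Matrix.one_mul, Matrix.mul_assoc]
    abel
  have := congrArg Matrix.det key
  rw [Matrix.det_mul, Matrix.det_mul, Matrix.det_one_add_mul_comm V', Matrix.det_one_add_mul_comm V',
    Matrix.mul_assoc (D - 1), Matrix.mul_assoc (D - K' - 1), e3, Matrix.mul_one, Matrix.mul_one, add_sub_cancel,
    add_sub_cancel] at this
  rw [Matrix.charpoly, Matrix.charpoly, Matrix.charpoly, Matrix.charpoly, e4, e5]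
  exact this

lemma aux_block {S : ℕ} (p : Fin S → ℕ) (A : ∀ j, Matrix (Fin (p j)) (Fin (p j)) ℝ) :
    (Matrix.blockDiagonal' A).charpoly = ∏ j, (A j).charpoly := by
  have h : (charmatrix (Matrix.blockDiagonal' A)).BlockTriangular Sigma.fst :=
    Matrix.BlockTriangular.charmatrix (Matrix.blockTriangular_blockDiagonal' A)
  rw [Matrix.charpoly, h.det_fintype]
  refine Finset.prod_congr rfl fun j _ => ?_
  rw [Matrix.charpoly, ← Matrix.det_submatrix_equiv_self (Equiv.sigmaSubtype (β := fun j => Fin (p j)) j).symm]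
  congr 1
  ext a b : 1
  show charmatrix (Matrix.blockDiagonal' A) ⟨j, a⟩ ⟨j, b⟩ = charmatrix (A j) a b
  simp [ Matrix.charmatrix_apply, Matrix.blockDiagonal'_apply,
    Matrix.diagonal_apply]

lemma aux_conj {n : ℕ} {N : Type*} [Fintype N] [DecidableEq N] (hN : Fintype.card N = n)
    (σ : Equiv.Perm N) (hσ : ∀ x, σ (σ x) = x)
    (hfix : ∀ x y, σ x = x → σ y = y → x = y) :
    ∃ e : N ≃ Fin n, ∀ x, e (σ x) = (e x).rev := by
  classical
  have e0 : N ≃ Fin n := Fintype.equivFinOfCardEq hN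
  have aux : ∀ τ : Equiv.Perm (Fin n), (∀ x, τ (τ x) = x) → (∀ x y, τ x = x → τ y = y → x = y) →
      τ.cycleType = Multiset.replicate (n / 2) 2 := by
    intro τ h1 h2
    have hp : τ ^ 2 = 1 := by ext x; simp [pow_two, h1]
    have hc := Equiv.Perm.cycleType_of_pow_prime_eq_one hp
    have hs := τ.sum_cycleType
    rw [hc, Multiset.sum_replicate, smul_eq_mul] at hs
    have h3 : (τ.supportᶜ).card ≤ 1 := by
      rw [Finset.card_le_one]
      intro a ha b hb
      simp only [Finset.mem_compl, Equiv.Perm.mem_support, not_not] at ha hb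
      exact h2 a b ha hb
    rw [Finset.card_compl, Fintype.card_fin] at h3
    have h4 := τ.support.card_le_univ
    rw [Fintype.card_fin] at h4
    rw [hc]
    congr 1
    omega
  have c1 := aux (e0.permCongr σ) (by intro x; simp [hσ]) (by
    intro x y hx hy
    simp only [Equiv.permCongr_apply] at hx hy
    have := hfix (e0.symm x) (e0.symm y) (by rw [Equiv.eq_symm_apply]; exact hx)
      (by rw [Equiv.eq_symm_apply]; exact hy)
    exact e0.symm.injective this)
  have c2 := aux Fin.revPerm (by intro x; simp) (by
    intro x y hx hy
    simp only [Fin.revPerm_apply, Fin.ext_iff, Fin.val_rev] at hx hy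
    ext
    omega)
  have hconj : IsConj (e0.permCongr σ) Fin.revPerm := by
    rw [Equiv.Perm.isConj_iff_cycleType_eq, c1, c2]
  obtain ⟨g, hg⟩ := isConj_iff.1 hconj
  refine ⟨e0.trans g, fun x => ?_⟩
  have := congrArg (fun f : Equiv.Perm (Fin n) => f (g (e0 x))) hg
  simpa using this

/-- Soto-type condition for the BNIEP (Theorem 3.7): given a partition
`Λ₁ ∪ … ∪ Λ_S` of `{λ₁, …, λₙ}` with at most one part of odd size, where `top j` is the
largest element `λ_{j1} ≥ 0` of part `Λⱼ` and `top 1 = λ₁`, if each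
`Γⱼ = {ωⱼ, λ_{j2}, …, λ_{j pⱼ}}` is realizable by a nonnegative bisymmetric matrix with
Perron root `ωⱼ` and there is an `S × S` nonnegative symmetric matrix with eigenvalues
`λ_{11}, …, λ_{S1}` and diagonal `ω₁, …, ω_S`, then `{λ₁, …, λₙ}` is realizable by a
nonnegative bisymmetric matrix. -/
theorem bniep_soto (n S : ℕ) (hn : 0 < n) (hS : 0 < S) (hSn : S ≤ n)
    (lam : Fin n → ℝ) (hanti : Antitone lam)
    (ω : Fin S → ℝ) (hω0 : ∀ k, 0 ≤ ω k) (hω1 : ∀ k, ω k ≤ lam ⟨0, hn⟩)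
    (Λ : Fin S → Multiset ℝ) (top : Fin S → ℝ)
    (hpart : (∑ j, Λ j) = Finset.univ.val.map lam)
    (hoddone : (Finset.univ.filter fun j : Fin S => Odd (Multiset.card (Λ j))).card ≤ 1)
    (htopmem : ∀ j, top j ∈ Λ j)
    (htopmax : ∀ j, ∀ x ∈ Λ j, x ≤ top j)
    (htopnn : ∀ j, 0 ≤ top j)
    (htop1 : top ⟨0, hS⟩ = lam ⟨0, hn⟩)
    (h1 : ∀ j : Fin S,
      ∃ A : Matrix (Fin (Multiset.card (Λ j))) (Fin (Multiset.card (Λ j))) ℝ,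
        MatNonneg A ∧ IsBisymm A ∧ HasEigsM A (ω j ::ₘ (Λ j).erase (top j)) ∧
          IsPerronRoot A (ω j))
    (h2 : ∃ B : Matrix (Fin S) (Fin S) ℝ, MatNonneg B ∧ Bᵀ = B ∧
        HasEigsM B (Finset.univ.val.map top) ∧ ∀ j, B j j = ω j) :
    ∃ Q : Matrix (Fin n) (Fin n) ℝ, MatNonneg Q ∧ IsBisymm Q ∧ HasEigs Q lam := by
  classical
  choose A hAn hAb hAe hAp using h1
  obtain ⟨B, hBn, hBs, hBe, hBd⟩ := h2
  choose x hx1 hxn hxr hxA using fun j => aux_perron_sym (A j) (ω j) (hAn j) (hAb j) (hAp j)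
  let N := Σ j : Fin S, Fin (Multiset.card (Λ j))
  let V : Matrix N (Fin S) ℝ := Matrix.of fun s k => if s.1 = k then x s.1 s.2 else 0
  have hV : ∀ s k, V s k = if s.1 = k then x s.1 s.2 else 0 := fun _ _ => rfl
  let A' : Matrix N N ℝ := Matrix.blockDiagonal' A
  have hA't : A'ᵀ = A' := by
    show (Matrix.blockDiagonal' A)ᵀ = Matrix.blockDiagonal' A
    rw [Matrix.blockDiagonal'_transpose]
    congr 1
    funext j
    exact (hAb j).1
  let K : Matrix (Fin S) (Fin S) ℝ := B - Matrix.diagonal ω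
  have hKn : ∀ i j, 0 ≤ K i j := by
    intro i j
    by_cases h : i = j
    · subst h
      simp [K, hBd]
    · simpa [K, h] using hBn i j
  have hKs : Kᵀ = K := by
    simp only [K, Matrix.transpose_sub, hBs, Matrix.diagonal_transpose]
  have e1 : A' * V = V * Matrix.diagonal ω := by
    ext ⟨i, a⟩ k
    rw [Matrix.mul_diagonal, Matrix.mul_apply, Fintype.sum_sigma, Finset.sum_eq_single i]
    · have h := congrFun (hxA i) a
      simp only [Matrix.mulVec, dotProduct, Pi.smul_apply, smul_eq_mul] at h
      simp only [hV, A', Matrix.blockDiagonal'_apply_eq]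
      by_cases hik : i = k
      · subst hik
        simp only [if_true]
        rw [h, mul_comm]
      · simp [hik]
    · intro j _ hj
      refine Finset.sum_eq_zero fun b _ => ?_
      simp only [A']
      rw [Matrix.blockDiagonal'_apply_ne _ _ _ (Ne.symm hj), zero_mul]
    · intro h
      exact absurd (Finset.mem_univ _) h
  have e2 : Vᵀ * A' = Matrix.diagonal ω * Vᵀ := by
    have := congrArg Matrix.transpose e1
    rwa [Matrix.transpose_mul, Matrix.transpose_mul, hA't, Matrix.diagonal_transpose] at this
  have e3 : Vᵀ * V = 1 := by
    ext k l
    rw [Matrix.mul_apply, Fintype.sum_sigma, Finset.sum_eq_single k]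
    · simp only [Matrix.transpose_apply, hV, if_true]
      by_cases hkl : k = l
      · subst hkl
        simpa [dotProduct] using hx1 k
      · simp [hkl]
    · intro j _ hj
      refine Finset.sum_eq_zero fun b _ => ?_
      simp [hV, hj]
    · intro h
      exact absurd (Finset.mem_univ _) h
  have hrado := aux_rado A' V (Matrix.diagonal ω) K e1 e2 e3
  have hBK : Matrix.diagonal ω + K = B := by simp [K]
  have hBc : B.charpoly = ∏ j, (X - Polynomial.C (top j)) := by
    rw [hBe, Multiset.map_map]
    rfl
  have hAc : A'.charpoly = ∏ j, (X - Polynomial.C (ω j)) *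
      (((Λ j).erase (top j)).map fun a => X - Polynomial.C a).prod := by
    rw [aux_block]
    refine Finset.prod_congr rfl fun j _ => ?_
    rw [hAe j, Multiset.map_cons, Multiset.prod_cons]
  have hlam : ∏ i, (X - Polynomial.C (lam i)) =
      ∏ j, ((Λ j).map fun a => X - Polynomial.C a).prod := by
    have h1 : ∏ i, (X - Polynomial.C (lam i)) =
        ((Finset.univ.val.map lam).map fun a => X - Polynomial.C a).prod := by
      rw [Multiset.map_map]
      rfl
    rw [h1, ← hpart]
    have : ∀ s : Finset (Fin S), ((∑ j ∈ s, Λ j).map fun a => (X - Polynomial.C a : ℝ[X])).prod =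
        ∏ j ∈ s, ((Λ j).map fun a => X - Polynomial.C a).prod := by
      intro s
      induction s using Finset.induction_on with
      | empty => simp
      | insert a s ha ih =>
        rw [Finset.sum_insert ha, Finset.prod_insert ha, Multiset.map_add, Multiset.prod_add, ih]
    exact this _
  have hMc : (A' + V * K * Vᵀ).charpoly = ∏ i, (X - Polynomial.C (lam i)) := by
    rw [hBK, hAc, hBc, Matrix.charpoly_diagonal, Finset.prod_mul_distrib, mul_assoc] at hrado
    have hne : (∏ j, (X - Polynomial.C (ω j)) : ℝ[X]) ≠ 0 :=
      Finset.prod_ne_zero_iff.2 fun j _ => Polynomial.X_sub_C_ne_zero _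
    rw [mul_left_cancel₀ hne hrado, hlam, ← Finset.prod_mul_distrib]
    refine Finset.prod_congr rfl fun j _ => ?_
    rw [mul_comm, ← Multiset.prod_cons, ← Multiset.map_cons (fun a => X - Polynomial.C a),
      Multiset.cons_erase (htopmem j)]
  have hcard : Fintype.card N = n := by
    have := congrArg Multiset.card hpart
    rw [Multiset.card_sum, Multiset.card_map] at this
    simpa [N] using this
  let σ : Equiv.Perm N := Equiv.sigmaCongrRight fun j => Fin.revPerm
  have hσ : ∀ j a, σ ⟨j, a⟩ = ⟨j, a.rev⟩ := fun _ _ => rfl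
  obtain ⟨e, he⟩ := aux_conj hcard σ (by rintro ⟨j, a⟩; simp [hσ]) (by
    rintro ⟨j, a⟩ ⟨k, b⟩ ha hb
    rw [hσ, Sigma.mk.injEq] at ha hb
    have ha' := congrArg Fin.val (eq_of_heq ha.2)
    have hb' := congrArg Fin.val (eq_of_heq hb.2)
    rw [Fin.val_rev] at ha' hb'
    have hjo : Odd (Multiset.card (Λ j)) := ⟨a, by have := a.2; omega⟩
    have hko : Odd (Multiset.card (Λ k)) := ⟨b, by have := b.2; omega⟩
    have hjk : j = k := Finset.card_le_one.1 hoddone j (by simpa using hjo) k (by simpa using hko)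
    subst hjk
    congr 1
    ext
    have := a.2
    have := b.2
    omega)
  have hVn : ∀ s k, 0 ≤ V s k := by
    intro s k
    rw [hV]
    split_ifs
    · exact hxn _ _
    · exact le_rfl
  have hVσ : ∀ s k, V (σ s) k = V s k := by
    rintro ⟨j, a⟩ k
    rw [hσ, hV, hV]
    simp only [hxr]
  have hA'n : ∀ s t, 0 ≤ A' s t := by
    rintro ⟨i, a⟩ ⟨j, b⟩
    by_cases h : i = j
    · subst h
      simp only [A', Matrix.blockDiagonal'_apply_eq]
      exact hAn i a b
    · simp only [A']
      rw [Matrix.blockDiagonal'_apply_ne _ _ _ h]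
  have hA'σ : ∀ s t, A' (σ s) (σ t) = A' s t := by
    rintro ⟨i, a⟩ ⟨j, b⟩
    rw [hσ, hσ]
    by_cases h : i = j
    · subst h
      simp only [A', Matrix.blockDiagonal'_apply_eq]
      have h3 := (hAb i).2
      rw [aux_revId_conj] at h3
      exact congrFun (congrFun h3 a) b
    · simp only [A']
      rw [Matrix.blockDiagonal'_apply_ne _ _ _ h, Matrix.blockDiagonal'_apply_ne _ _ _ h]
  have hMn : ∀ s t, 0 ≤ (A' + V * K * Vᵀ) s t := by
    intro s t
    rw [Matrix.add_apply, Matrix.mul_apply]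
    refine add_nonneg (hA'n s t) (Finset.sum_nonneg fun k _ => mul_nonneg ?_ (hVn t k))
    rw [Matrix.mul_apply]
    exact Finset.sum_nonneg fun l _ => mul_nonneg (hVn s l) (hKn l k)
  have hMσ : ∀ s t, (A' + V * K * Vᵀ) (σ s) (σ t) = (A' + V * K * Vᵀ) s t := by
    intro s t
    simp only [Matrix.add_apply, Matrix.mul_apply, Matrix.transpose_apply, hVσ, hA'σ]
  have hMt : (A' + V * K * Vᵀ)ᵀ = A' + V * K * Vᵀ := by
    rw [Matrix.transpose_add, hA't, Matrix.transpose_mul, Matrix.transpose_mul, hKs,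
      Matrix.transpose_transpose, Matrix.mul_assoc]
  refine ⟨Matrix.reindex e e (A' + V * K * Vᵀ), ?_, ⟨?_, ?_⟩, ?_⟩
  · intro i j
    exact hMn _ _
  · rw [Matrix.transpose_reindex, hMt]
  · rw [aux_revId_conj]
    ext i j
    have h4 : ∀ i, e.symm i.rev = σ (e.symm i) := by
      intro i
      rw [Equiv.symm_apply_eq, he, Equiv.apply_symm_apply]
    simp only [Matrix.submatrix_apply, Matrix.reindex_apply, h4]
    exact hMσ _ _
  · rw [HasEigs, Matrix.charpoly_reindex, hMc]
end

section
/- Let Q be an (n+1)×(n+1) nonnegative bisymmetric real matrix whose eigenvalues (with multiplicity) are λ0 ≥ λ1 ≥ ... ≥ λn. Then for every ε > 0 there exists an (n+1)×(n+1) positive bisymmetric real matrix P such that the eigenvalues (with multiplicity) of Q + P are λ0 + ε, λ1, ..., λn. -/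
open Matrix Polynomial BigOperators

lemma aux_brauer {n : ℕ} (A : Matrix (Fin n) (Fin n) ℝ) (x : Fin n → ℝ) (l d : ℝ)
    (hx : x ⬝ᵥ x = 1) (hA : A *ᵥ x = l • x) :
    (X - C l) * (A + d • vecMulVec x x).charpoly = (X - C (l + d)) * A.charpoly := by
  apply Polynomial.funext
  intro t
  simp only [eval_mul, eval_sub, eval_X, eval_C, Matrix.eval_charpoly]
  by_cases ht : t = l
  · subst ht
    have h0 : (Matrix.scalar (Fin n) t - A).det = 0 := by
      rw [← Matrix.exists_mulVec_eq_zero_iff]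
      refine ⟨x, ?_, ?_⟩
      · rintro rfl
        simp at hx
      · rw [Matrix.sub_mulVec, hA]
        ext i
        simp [Matrix.scalar_apply, Matrix.mulVec_diagonal]
    rw [h0]; simp
  · have ht' : t - l ≠ 0 := sub_ne_zero.mpr ht
    have h1 : Matrix.scalar (Fin n) t - (A + d • vecMulVec x x)
        = (Matrix.scalar (Fin n) t - A) *
          (1 + replicateCol Unit (-(d / (t - l)) • x) * replicateRow Unit x) := by
      rw [← Matrix.vecMulVec_eq, Matrix.smul_vecMulVec, Matrix.mul_add, Matrix.mul_one,
        Matrix.mul_smul, Matrix.mul_vecMulVec, Matrix.sub_mulVec, hA]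
      ext i j
      simp [Matrix.scalar_apply, Matrix.mulVec_diagonal, Matrix.vecMulVec_apply]
      field_simp
      ring
    rw [h1, Matrix.det_mul, Matrix.det_one_add_replicateCol_mul_replicateRow]
    rw [dotProduct_smul, hx]
    simp only [smul_eq_mul]
    field_simp
    ring

lemma aux_root {n : ℕ} (A : Matrix (Fin n) (Fin n) ℝ) (b : ℝ) :
    A.charpoly.eval b = 0 ↔ ∃ v, v ≠ 0 ∧ A *ᵥ v = b • v := by
  rw [Matrix.eval_charpoly, ← Matrix.exists_mulVec_eq_zero_iff]
  apply exists_congr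
  intro v
  apply and_congr Iff.rfl
  rw [Matrix.sub_mulVec, sub_eq_zero]
  have : (Matrix.scalar (Fin n) b) *ᵥ v = b • v := by
    ext i; simp [Matrix.scalar_apply, Matrix.mulVec_diagonal]
  rw [this, eq_comm]

lemma aux_bisymm {n : ℕ} (Q : Matrix (Fin n) (Fin n) ℝ) :
    IsBisymm Q ↔ (∀ i j, Q i j = Q j i) ∧ ∀ i j, Q i.rev j.rev = Q i j := by
  have hJ : revId n = Matrix.of fun i j => if j = Fin.rev i then (1:ℝ) else 0 := by
    ext i j
    simp only [revId, Matrix.of_apply]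
    congr 1
    simp only [Fin.ext_iff, Fin.val_rev, eq_iff_iff]
    omega
  have h2 : revId n * Q * revId n = Matrix.of fun i j => Q i.rev j.rev := by
    ext i j
    rw [hJ]
    simp only [Matrix.mul_apply, Matrix.of_apply, ite_mul, one_mul, zero_mul,
      Finset.sum_ite_eq', Finset.mem_univ, if_true, mul_ite, mul_one, mul_zero]
    rw [Finset.sum_eq_single j.rev]
    · simp
    · intro b _ hb
      rw [if_neg]
      rintro rfl
      simp at hb
    · simp
  unfold IsBisymm
  rw [h2, ← Matrix.ext_iff, ← Matrix.ext_iff]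
  simp only [Matrix.transpose_apply, Matrix.of_apply]
  exact and_congr_left' ⟨fun h i j => h j i, fun h i j => h j i⟩

lemma aux_perron_s15 {n : ℕ} (N : Matrix (Fin (n+1)) (Fin (n+1)) ℝ) (hN : MatNonneg N)
    (hb : IsBisymm N) :
    ∃ (w : Fin (n+1) → ℝ) (b : ℝ), (∀ i, 0 ≤ w i) ∧ w ⬝ᵥ w = 1 ∧ (∀ i, w i.rev = w i) ∧
      N *ᵥ w = b • w ∧ ∀ v, v ⬝ᵥ N *ᵥ v ≤ b * (v ⬝ᵥ v) := by
  have hcomp : IsCompact {x : Fin (n+1) → ℝ | x ⬝ᵥ x = 1} := by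
    apply Metric.isCompact_of_isClosed_isBounded
    · exact isClosed_eq (by unfold dotProduct; fun_prop) continuous_const
    · refine (Metric.isBounded_closedBall (x := (0 : Fin (n+1) → ℝ)) (r := 1)).subset ?_
      intro x hx
      rw [mem_closedBall_zero_iff, pi_norm_le_iff_of_nonneg zero_le_one]
      intro i
      have h1 : x i * x i ≤ x ⬝ᵥ x :=
        Finset.single_le_sum (f := fun i => x i * x i) (fun i _ => mul_self_nonneg _)
          (Finset.mem_univ i)
      rw [show x ⬝ᵥ x = 1 from hx] at h1
      rw [Real.norm_eq_abs, abs_le]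
      constructor <;> nlinarith
  have hne : {x : Fin (n+1) → ℝ | x ⬝ᵥ x = 1}.Nonempty := by
    refine ⟨Pi.single 0 1, ?_⟩
    simp
  obtain ⟨x, hx, hmax⟩ := hcomp.exists_isMaxOn hne (f := fun x => x ⬝ᵥ N *ᵥ x)
    (by unfold dotProduct mulVec dotProduct; fun_prop)
  set b := x ⬝ᵥ N *ᵥ x with hbdef
  have hx : x ⬝ᵥ x = 1 := hx
  have htop : ∀ v, v ⬝ᵥ N *ᵥ v ≤ b * (v ⬝ᵥ v) := by
    intro v
    have h0 : 0 ≤ v ⬝ᵥ v := Finset.sum_nonneg fun i _ => mul_self_nonneg _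
    rcases h0.eq_or_lt with h | h
    · have : v = 0 := by simpa using h.symm
      subst this; simp
    · have hs : Real.sqrt (v ⬝ᵥ v) ≠ 0 := (Real.sqrt_pos.mpr h).ne'
      have hs2 : Real.sqrt (v ⬝ᵥ v) * Real.sqrt (v ⬝ᵥ v) = v ⬝ᵥ v := Real.mul_self_sqrt h0
      have h1 : ((Real.sqrt (v ⬝ᵥ v))⁻¹ • v) ∈ {x : Fin (n+1) → ℝ | x ⬝ᵥ x = 1} := by
        simp only [Set.mem_setOf_eq, smul_dotProduct, dotProduct_smul, smul_eq_mul]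
        rw [← mul_assoc, ← mul_inv, hs2, inv_mul_cancel₀ h.ne']
      have h2 := hmax h1
      simp only [Set.mem_setOf_eq, Matrix.mulVec_smul, smul_dotProduct, dotProduct_smul,
        smul_eq_mul] at h2
      rw [← mul_assoc, ← mul_inv, hs2, inv_mul_le_iff₀ h] at h2
      linarith
  have hsymm := ((aux_bisymm N).1 hb).1
  have hrev := ((aux_bisymm N).1 hb).2
  have hpsd : (b • (1 : Matrix (Fin (n+1)) (Fin (n+1)) ℝ) - N).PosSemidef := by
    rw [Matrix.posSemidef_iff_dotProduct_mulVec]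
    constructor
    · ext i j
      simp [hsymm i j, Matrix.one_apply, eq_comm]
    · intro v
      have := htop v
      simp only [star_trivial, Matrix.sub_mulVec, Matrix.smul_mulVec, Matrix.one_mulVec,
        dotProduct_sub, dotProduct_smul, smul_eq_mul]
      linarith
  have habs : N *ᵥ (fun i => |x i|) = b • (fun i => |x i|) := by
    have hxx : (fun i => |x i|) ⬝ᵥ (fun i => |x i|) = 1 := by
      rw [← hx]; simp [dotProduct]
    have hge : b ≤ (fun i => |x i|) ⬝ᵥ N *ᵥ (fun i => |x i|) := by
      rw [hbdef]
      simp only [dotProduct, mulVec, Finset.mul_sum]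
      refine Finset.sum_le_sum fun i _ => Finset.sum_le_sum fun j _ => ?_
      calc x i * (N i j * x j) ≤ |x i * (N i j * x j)| := le_abs_self _
        _ = |x i| * (N i j * |x j|) := by
          rw [abs_mul, abs_mul, abs_of_nonneg (hN i j)]
    have hle := htop (fun i => |x i|)
    rw [hxx] at hle
    have := (hpsd.dotProduct_mulVec_zero_iff (fun i => |x i|)).1 (by
      simp only [star_trivial, Matrix.sub_mulVec, Matrix.smul_mulVec, Matrix.one_mulVec,
        dotProduct_sub, dotProduct_smul, smul_eq_mul]
      rw [hxx]; linarith)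
    rw [Matrix.sub_mulVec, Matrix.smul_mulVec, Matrix.one_mulVec, sub_eq_zero] at this
    exact this.symm
  set y : Fin (n+1) → ℝ := fun i => |x i| + |x i.rev| with hy
  have hyN : N *ᵥ y = b • y := by
    ext i
    have e1 := congrFun habs i
    have e2 := congrFun habs i.rev
    simp only [mulVec, dotProduct, Pi.smul_apply, smul_eq_mul] at e1 e2 ⊢
    rw [← Equiv.sum_comp Fin.revPerm] at e2
    simp only [Fin.revPerm_apply, hrev] at e2
    simp only [hy, mul_add, Finset.sum_add_distrib]
    rw [e1, e2]
  have hynn : ∀ i, 0 ≤ y i := fun i => by positivity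
  have hyy : 0 < y ⬝ᵥ y := by
    have h1 : x ⬝ᵥ x ≤ y ⬝ᵥ y := by
      refine Finset.sum_le_sum fun i _ => ?_
      rw [← abs_mul_abs_self (x i)]
      have : |x i| ≤ y i := by simp [hy]
      exact mul_self_le_mul_self (abs_nonneg _) this
    linarith
  refine ⟨(Real.sqrt (y ⬝ᵥ y))⁻¹ • y, b, ?_, ?_, ?_, ?_, htop⟩
  · intro i
    exact mul_nonneg (by positivity) (hynn i)
  · have hs2 := Real.mul_self_sqrt hyy.le
    simp only [smul_dotProduct, dotProduct_smul, smul_eq_mul]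
    rw [← mul_assoc, ← mul_inv, hs2, inv_mul_cancel₀ hyy.ne']
  · intro i
    simp [hy, add_comm]
  · rw [Matrix.mulVec_smul, hyN, smul_comm]

/-- A second nonnegative eigenvector, supported on the zero set of `u`. -/
lemma aux_second {n : ℕ} (Q : Matrix (Fin (n+1)) (Fin (n+1)) ℝ) (hQ : MatNonneg Q)
    (hb : IsBisymm Q) (u : Fin (n+1) → ℝ) (l : ℝ) (hu : ∀ i, 0 ≤ u i)
    (hur : ∀ i, u i.rev = u i) (hQu : Q *ᵥ u = l • u) (i₀ : Fin (n+1)) (hi₀ : u i₀ = 0) :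
    ∃ (w : Fin (n+1) → ℝ) (b : ℝ), (∀ i, 0 ≤ w i) ∧ w ⬝ᵥ w = 1 ∧ (∀ i, w i.rev = w i) ∧
      Q *ᵥ w = b • w ∧ ∀ i, u i ≠ 0 → w i = 0 := by
  obtain ⟨hsymm, hrev⟩ := (aux_bisymm Q).1 hb
  let N : Matrix (Fin (n+1)) (Fin (n+1)) ℝ := Matrix.of fun i j =>
    if u i = 0 ∧ u j = 0 then Q i j + (1 : Matrix (Fin (n+1)) (Fin (n+1)) ℝ) i j else 0
  have hNa : ∀ i j, N i j = if u i = 0 ∧ u j = 0 then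
    Q i j + (1 : Matrix (Fin (n+1)) (Fin (n+1)) ℝ) i j else 0 := fun i j => rfl
  have hone : ∀ i j, 0 ≤ (1 : Matrix (Fin (n+1)) (Fin (n+1)) ℝ) i j := by
    intro i j; rw [Matrix.one_apply]; split_ifs <;> norm_num
  obtain ⟨w, b, hw, hww, hwr, hNw, htop⟩ := aux_perron_s15 N
    (by
      intro i j
      rw [hNa]
      split_ifs
      · exact add_nonneg (hQ i j) (hone i j)
      · exact le_rfl)
    (by
      rw [aux_bisymm]
      constructor
      · intro i j
        rw [hNa, hNa, hsymm i j]
        simp only [and_comm (a := u i = 0), Matrix.one_apply, eq_comm (a := i)]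
      · intro i j
        rw [hNa, hNa, hrev, hur, hur]
        simp [Matrix.one_apply])
  have hb1 : 1 ≤ b := by
    have := htop (Pi.single i₀ 1)
    simp [hNa, hi₀] at this
    linarith [hQ i₀ i₀]
  have hsupp : ∀ i, u i ≠ 0 → w i = 0 := by
    intro i hi
    have := congrFun hNw i
    simp only [mulVec, dotProduct, hNa, hi, false_and, if_false, zero_mul,
      Finset.sum_const_zero, Pi.smul_apply, smul_eq_mul] at this
    rcases mul_eq_zero.1 this.symm with h | h
    · linarith
    · exact h
  have hblock : ∀ i j, u i ≠ 0 → u j = 0 → Q i j = 0 := by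
    intro i j hi hj
    have := congrFun hQu j
    simp only [mulVec, dotProduct, Pi.smul_apply, smul_eq_mul, hj, mul_zero] at this
    rw [Finset.sum_eq_zero_iff_of_nonneg (fun k _ => mul_nonneg (hQ j k) (hu k))] at this
    have := this i (Finset.mem_univ _)
    rw [hsymm]
    exact (mul_eq_zero.1 this).resolve_right hi
  refine ⟨w, b - 1, hw, hww, hwr, ?_, hsupp⟩
  ext i
  by_cases hi : u i = 0
  · have h1 := congrFun hNw i
    have h2 : (N *ᵥ w) i = ((Q + 1) *ᵥ w) i := by
      simp only [mulVec, dotProduct]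
      refine Finset.sum_congr rfl fun j _ => ?_
      by_cases hj : u j = 0
      · simp [hNa, hi, hj]
      · simp [hsupp j hj]
    rw [h2, Matrix.add_mulVec, Matrix.one_mulVec] at h1
    simp only [Pi.add_apply, Pi.smul_apply, smul_eq_mul] at h1 ⊢
    linarith
  · simp only [Pi.smul_apply, smul_eq_mul, hsupp i hi, mul_zero, mulVec, dotProduct]
    refine Finset.sum_eq_zero fun j _ => ?_
    by_cases hj : u j = 0
    · rw [hblock i j hi hj, zero_mul]
    · rw [hsupp j hj, mul_zero]

lemma aux_vmv {n : ℕ} (x y : Fin n → ℝ) : vecMulVec x x *ᵥ y = (x ⬝ᵥ y) • x := by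
  ext i
  simp [mulVec, dotProduct, vecMulVec_apply, Finset.mul_sum, mul_comm, mul_left_comm]

lemma aux_merge {n : ℕ} (Q : Matrix (Fin n) (Fin n) ℝ) (u w : Fin n → ℝ) (l b m c s : ℝ)
    (huu : u ⬝ᵥ u = 1) (hww : w ⬝ᵥ w = 1) (huw : u ⬝ᵥ w = 0)
    (hu : Q *ᵥ u = l • u) (hw : Q *ᵥ w = b • w) (hcs : c * c + s * s = 1) :
    let P := (-l) • vecMulVec u u + (-b) • vecMulVec w w
      + m • vecMulVec (c • u + s • w) (c • u + s • w)
      + b • vecMulVec (-s • u + c • w) (-s • u + c • w)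
    (X - C l) * (Q + P).charpoly = (X - C m) * Q.charpoly ∧
      (Q + P) *ᵥ (c • u + s • w) = m • (c • u + s • w) := by
  intro P
  have hwu : w ⬝ᵥ u = 0 := by rw [dotProduct_comm, huw]
  set x := c • u + s • w with hx
  set y := -s • u + c • w with hy
  have hxx : x ⬝ᵥ x = 1 := by
    simp only [hx, add_dotProduct, dotProduct_add, smul_dotProduct, dotProduct_smul, huu, hww,
      huw, hwu, smul_eq_mul]
    linarith
  have hyy : y ⬝ᵥ y = 1 := by
    simp only [hy, add_dotProduct, dotProduct_add, smul_dotProduct, dotProduct_smul, huu, hww,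
      huw, hwu, smul_eq_mul]
    linarith
  have hxy : x ⬝ᵥ y = 0 := by
    simp only [hx, hy, add_dotProduct, dotProduct_add, smul_dotProduct, dotProduct_smul, huu, hww,
      huw, hwu, smul_eq_mul]
    ring
  have hyx : y ⬝ᵥ x = 0 := by rw [dotProduct_comm, hxy]
  set A1 := Q + (-l) • vecMulVec u u with hA1
  set A2 := A1 + (-b) • vecMulVec w w with hA2
  set A3 := A2 + m • vecMulVec x x with hA3
  have hQP : Q + P = A3 + b • vecMulVec y y := by
    simp only [P, hA1, hA2, hA3, hx, hy, add_assoc]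
  have e1 : A1 *ᵥ w = b • w := by
    rw [hA1, Matrix.add_mulVec, Matrix.smul_mulVec, aux_vmv, huw, hw]; simp
  have e1' : A1 *ᵥ u = 0 := by
    rw [hA1, Matrix.add_mulVec, Matrix.smul_mulVec, aux_vmv, huu, hu]; simp
  have e2 : A2 *ᵥ w = 0 := by
    rw [hA2, Matrix.add_mulVec, Matrix.smul_mulVec, aux_vmv, hww, e1]; simp
  have e2' : A2 *ᵥ u = 0 := by
    rw [hA2, Matrix.add_mulVec, Matrix.smul_mulVec, aux_vmv, hwu, e1']; simp
  have e2x : A2 *ᵥ x = (0:ℝ) • x := by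
    rw [hx, Matrix.mulVec_add, Matrix.mulVec_smul, Matrix.mulVec_smul, e2, e2']; simp
  have e2y : A2 *ᵥ y = (0:ℝ) • y := by
    rw [hy, Matrix.mulVec_add, Matrix.mulVec_smul, Matrix.mulVec_smul, e2, e2']; simp
  have e3y : A3 *ᵥ y = (0:ℝ) • y := by
    rw [hA3, Matrix.add_mulVec, Matrix.smul_mulVec, aux_vmv, hxy, e2y]; simp
  have e3x : A3 *ᵥ x = m • x := by
    rw [hA3, Matrix.add_mulVec, Matrix.smul_mulVec, aux_vmv, hxx, e2x]; simp
  rw [hQP]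
  constructor
  · have b1 := aux_brauer Q u l (-l) huu hu
    have b2 := aux_brauer A1 w b (-b) hww e1
    have b3 := aux_brauer A2 x 0 m hxx e2x
    have b4 := aux_brauer A3 y 0 b hyy e3y
    rw [← hA1] at b1
    rw [← hA2] at b2
    rw [← hA3] at b3
    simp only [add_neg_cancel, C_0, sub_zero, zero_add] at b1 b2 b3 b4
    have hX : (X * X * (X - C b) : ℝ[X]) ≠ 0 :=
      mul_ne_zero (mul_ne_zero X_ne_zero X_ne_zero) (X_sub_C_ne_zero b)
    apply mul_left_cancel₀ hX
    linear_combination X * (X - C b) * (X - C l) * b4 + (X - C b) * (X - C b) * (X - C l) * b3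
      + (X - C m) * (X - C b) * (X - C l) * b2 + X * (X - C m) * (X - C b) * b1
  · rw [Matrix.add_mulVec, Matrix.smul_mulVec, aux_vmv, hyx, e3x]; simp

lemma aux_main {n : ℕ} (k : ℕ) : ∀ (Q : Matrix (Fin (n+1)) (Fin (n+1)) ℝ)
    (u : Fin (n+1) → ℝ) (l ε : ℝ), MatNonneg Q → IsBisymm Q → (∀ i, 0 ≤ u i) → u ⬝ᵥ u = 1 →
    (∀ i, u i.rev = u i) → Q *ᵥ u = l • u → (∀ b, Q.charpoly.eval b = 0 → b ≤ l) → 0 < ε →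
    (Finset.univ.filter fun i => u i = 0).card ≤ k →
    ∃ P : Matrix (Fin (n+1)) (Fin (n+1)) ℝ, MatPos P ∧ IsBisymm P ∧
      (X - C l) * (Q + P).charpoly = (X - C (l + ε)) * Q.charpoly := by
  induction k with
  | zero =>
    intro Q u l ε hQ hb hu huu hur hQu htop hε hk
    have hpos : ∀ i, 0 < u i := by
      intro i
      refine lt_of_le_of_ne (hu i) fun h => ?_
      have : i ∈ (Finset.univ.filter fun i => u i = 0) := by simp [h.symm]
      rw [Finset.card_eq_zero.1 (Nat.le_zero.1 hk)] at this
      simp at this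
    refine ⟨ε • vecMulVec u u, ?_, ?_, aux_brauer Q u l ε huu hQu⟩
    · intro i j
      simp only [Matrix.smul_apply, vecMulVec_apply, smul_eq_mul]
      exact mul_pos hε (mul_pos (hpos i) (hpos j))
    · rw [aux_bisymm]
      constructor
      · intro i j; simp [vecMulVec_apply, mul_comm]
      · intro i j; simp [vecMulVec_apply, hur]
  | succ k ih =>
    intro Q u l ε hQ hb hu huu hur hQu htop hε hk
    by_cases hz : ∃ i, u i = 0
    swap
    · refine ih Q u l ε hQ hb hu huu hur hQu htop hε ?_
      push Not at hz
      simp [hz]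
    obtain ⟨i₀, hi₀⟩ := hz
    obtain ⟨w, b, hw, hww, hwr, hQw, hsupp⟩ := aux_second Q hQ hb u l hu hur hQu i₀ hi₀
    have hbl : b ≤ l := by
      apply htop
      rw [aux_root]
      refine ⟨w, ?_, hQw⟩
      rintro rfl
      simp at hww
    have huw : u ⬝ᵥ w = 0 := by
      refine Finset.sum_eq_zero fun i _ => ?_
      by_cases hi : u i = 0
      · rw [hi, zero_mul]
      · rw [hsupp i hi, mul_zero]
    obtain ⟨d, hd⟩ : ∃ d, d = l + ε / 2 - b := ⟨_, rfl⟩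
    have hdε : ε / 2 ≤ d := by linarith
    have hdpos : 0 < d := by linarith
    have hq : 0 < ε / (4 * d) := by positivity
    have hq1 : ε / (4 * d) < 1 := by
      rw [div_lt_one (by positivity)]; linarith
    obtain ⟨s, hs⟩ : ∃ s, s = Real.sqrt (ε / (4 * d)) := ⟨_, rfl⟩
    obtain ⟨c, hc⟩ : ∃ c, c = Real.sqrt (1 - ε / (4 * d)) := ⟨_, rfl⟩
    have hspos : 0 < s := by rw [hs]; exact Real.sqrt_pos.2 hq
    have hcpos : 0 < c := by rw [hc]; exact Real.sqrt_pos.2 (by linarith)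
    have hss : s * s = ε / (4 * d) := by rw [hs]; exact Real.mul_self_sqrt hq.le
    have hcc : c * c = 1 - s * s := by
      rw [hss, hc]; exact Real.mul_self_sqrt (by linarith)
    have hds : d * (s * s) = ε / 4 := by rw [hss]; field_simp
    obtain ⟨hchar, heigx⟩ := aux_merge Q u w l b (l + ε / 2) c s huu hww huw hQu hQw (by linarith)
    set P := (-l) • vecMulVec u u + (-b) • vecMulVec w w
      + (l + ε / 2) • vecMulVec (c • u + s • w) (c • u + s • w)
      + b • vecMulVec (-s • u + c • w) (-s • u + c • w) with hP
    have hPa : ∀ i j, P i j = ε / 4 * (u i * u j) + d * (c * s) * (u i * w j + w i * u j)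
        + ε / 4 * (w i * w j) := by
      intro i j
      have : P i j = (-l + (l + ε / 2) * (c * c) + b * (s * s)) * (u i * u j)
          + d * (c * s) * (u i * w j + w i * u j)
          + (-b + (l + ε / 2) * (s * s) + b * (c * c)) * (w i * w j) := by
        simp only [hP, Matrix.add_apply, Matrix.smul_apply, vecMulVec_apply, Pi.add_apply,
          Pi.smul_apply, smul_eq_mul, hd]
        ring
      rw [this, hcc]
      have h1 : -l + (l + ε / 2) * (1 - s * s) + b * (s * s) = ε / 4 := by
        rw [hd] at hds; linarith
      have h2 : -b + (l + ε / 2) * (s * s) + b * (1 - s * s) = ε / 4 := by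
        rw [hd] at hds; linarith
      rw [h1, h2]
    have hPnn : ∀ i j, 0 ≤ P i j := by
      intro i j
      rw [hPa]
      have := hu i; have := hu j; have := hw i; have := hw j
      positivity
    have hPb : IsBisymm P := by
      rw [aux_bisymm]
      constructor
      · intro i j; rw [hPa, hPa]; ring
      · intro i j; rw [hPa, hPa, hur, hur, hwr, hwr]
    obtain ⟨hPs, hPr⟩ := (aux_bisymm P).1 hPb
    obtain ⟨hQs, hQr⟩ := (aux_bisymm Q).1 hb
    have hxx : (c • u + s • w) ⬝ᵥ (c • u + s • w) = 1 := by
      simp only [add_dotProduct, dotProduct_add, smul_dotProduct, dotProduct_smul, huu, hww,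
        huw, dotProduct_comm w u, smul_eq_mul]
      linarith
    obtain ⟨P2, hPpos2, hPb2, hPc2⟩ := ih (Q + P) (c • u + s • w) (l + ε / 2) (ε / 2)
      (fun i j => add_nonneg (hQ i j) (hPnn i j))
      (by
        rw [aux_bisymm]
        exact ⟨fun i j => by rw [Matrix.add_apply, Matrix.add_apply, hPs, hQs],
          fun i j => by rw [Matrix.add_apply, Matrix.add_apply, hPr, hQr]⟩)
      (fun i => add_nonneg (mul_nonneg hcpos.le (hu i)) (mul_nonneg hspos.le (hw i)))
      hxx
      (fun i => by simp [hur, hwr])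
      heigx
      (by
        intro t ht
        have := congrArg (Polynomial.eval t) hchar
        simp only [eval_mul, ht, mul_zero, eval_sub, eval_X, eval_C] at this
        rcases mul_eq_zero.1 this.symm with h | h
        · linarith
        · linarith [htop t h])
      (by linarith)
      (by
        have hlt : (Finset.univ.filter fun i => (c • u + s • w) i = 0).card
            < (Finset.univ.filter fun i => u i = 0).card := by
          have hzero : ∀ i, (c • u + s • w) i = 0 → u i = 0 ∧ w i = 0 := by
            intro i hi
            simp only [Pi.add_apply, Pi.smul_apply, smul_eq_mul] at hi
            rw [add_eq_zero_iff_of_nonneg (mul_nonneg hcpos.le (hu i))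
              (mul_nonneg hspos.le (hw i))] at hi
            exact ⟨(mul_eq_zero.1 hi.1).resolve_left hcpos.ne',
              (mul_eq_zero.1 hi.2).resolve_left hspos.ne'⟩
          obtain ⟨j, hj⟩ : ∃ j, w j ≠ 0 := by
            by_contra! h
            have : w = 0 := funext h
            rw [this] at hww
            simp at hww
          apply Finset.card_lt_card
          rw [Finset.ssubset_iff_of_subset]
          · refine ⟨j, ?_, ?_⟩
            · simp only [Finset.mem_filter, Finset.mem_univ, true_and]
              by_contra h
              exact hj (hsupp j h)
            · simp only [Finset.mem_filter, Finset.mem_univ, true_and]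
              exact fun h => hj (hzero j h).2
          · intro i hi
            simp only [Finset.mem_filter, Finset.mem_univ, true_and] at hi ⊢
            exact (hzero i hi).1
        omega)
    obtain ⟨hPs2, hPr2⟩ := (aux_bisymm P2).1 hPb2
    refine ⟨P + P2, fun i j => add_pos_of_nonneg_of_pos (hPnn i j) (hPpos2 i j), ?_, ?_⟩
    · rw [aux_bisymm]
      exact ⟨fun i j => by rw [Matrix.add_apply, Matrix.add_apply, hPs, hPs2],
          fun i j => by rw [Matrix.add_apply, Matrix.add_apply, hPr, hPr2]⟩
    · rw [← add_assoc]
      have hh : l + ε / 2 + ε / 2 = l + ε := by ring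
      rw [hh] at hPc2
      apply mul_left_cancel₀ (X_sub_C_ne_zero (l + ε / 2))
      linear_combination (X - C l) * hPc2 + (X - C (l + ε)) * hchar

/-- Corollary 4.4: if `Q` is nonnegative bisymmetric with eigenvalues `λ₀ ≥ λ₁ ≥ … ≥ λₙ`,
then for every `ε > 0` there is a positive bisymmetric matrix `P` such that `Q + P` has
eigenvalues `λ₀ + ε, λ₁, …, λₙ`. -/
theorem bisymm_positive_add_perturb (n : ℕ) (Q : Matrix (Fin (n + 1)) (Fin (n + 1)) ℝ)
    (hQnn : MatNonneg Q) (hQbs : IsBisymm Q)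
    (lam : ℕ → ℝ)
    (hanti : ∀ i j, i ≤ j → j ≤ n → lam j ≤ lam i)
    (heig : HasEigs Q fun i => lam (i : ℕ))
    (ε : ℝ) (hε : 0 < ε) :
    ∃ P : Matrix (Fin (n + 1)) (Fin (n + 1)) ℝ,
      MatPos P ∧ IsBisymm P ∧
        HasEigsM (Q + P) ((lam 0 + ε) ::ₘ (Finset.Icc 1 n).val.map lam) := by
  have heig' : Q.charpoly = ∏ i : Fin (n+1), (X - C (lam (i : ℕ))) := heig
  obtain ⟨u, b, hu, huu, hur, hQu, htop⟩ := aux_perron_s15 Q hQnn hQbs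
  have hroot : ∀ t, Q.charpoly.eval t = 0 → t ≤ lam 0 := by
    intro t ht
    rw [heig', eval_prod, Finset.prod_eq_zero_iff] at ht
    obtain ⟨i, _, hi⟩ := ht
    simp only [eval_sub, eval_X, eval_C] at hi
    have := hanti 0 i (Nat.zero_le _) (Nat.lt_succ_iff.1 i.2)
    linarith
  have hb1 : b ≤ lam 0 := by
    apply hroot
    rw [aux_root]
    refine ⟨u, ?_, hQu⟩
    rintro rfl
    simp at huu
  have hb2 : lam 0 ≤ b := by
    have h0 : Q.charpoly.eval (lam 0) = 0 := by
      rw [heig', eval_prod]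
      exact Finset.prod_eq_zero (Finset.mem_univ 0) (by simp)
    rw [aux_root] at h0
    obtain ⟨v, hv, hQv⟩ := h0
    have h1 := htop v
    rw [hQv, dotProduct_smul, smul_eq_mul] at h1
    have h2 : 0 < v ⬝ᵥ v := by
      refine lt_of_le_of_ne (Finset.sum_nonneg fun i _ => mul_self_nonneg _) ?_
      intro h
      exact hv (by simpa using h.symm)
    exact le_of_mul_le_mul_right h1 h2
  obtain rfl : b = lam 0 := le_antisymm hb1 hb2
  obtain ⟨P, hP, hPb, hPc⟩ := aux_main _ Q u (lam 0) ε hQnn hQbs hu huu hur hQu hroot hε le_rfl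
  refine ⟨P, hP, hPb, ?_⟩
  unfold HasEigsM
  rw [Multiset.map_cons, Multiset.prod_cons, Multiset.map_map]
  apply mul_left_cancel₀ (X_sub_C_ne_zero (lam 0))
  rw [hPc, heig', Fin.prod_univ_succ]
  have : (Multiset.map ((fun a => X - C a) ∘ lam) (Finset.Icc 1 n).val).prod
      = ∏ i : Fin n, (X - C (lam ((i.succ : Fin (n+1)) : ℕ))) := by
    change ∏ i ∈ Finset.Icc 1 n, (X - C (lam i)) = _
    simp only [Fin.val_succ]
    rw [Fin.prod_univ_eq_prod_range (fun i => X - C (lam (i + 1))) n, Finset.range_eq_Ico,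
      Finset.prod_Ico_add' (fun i => X - C (lam i)) 0 n 1]
    rfl
  rw [this]
  simp only [Fin.val_zero]
  ring
end

section
/- Let α0 ≥ α1 ≥ α2 be real numbers and let a0, a1 be nonnegative real numbers. Then there exists a 3×3 nonnegative bisymmetric real matrix whose eigenvalues (with multiplicity) are α0, α1, α2 and whose diagonal entries are, in order, a1, a0, a1, if and only if there exists j ∈ {1, 2} such that a1 ≥ αj, α0 + αj ≥ 2a1, α1 + α2 ≤ 2a1, and α0 + α1 + α2 = a0 + 2a1. -/
open Matrix Polynomial BigOperators

theorem bs_charpoly (a b c d : ℝ) : (!![a,b,c;b,d,b;c,b,a] : Matrix (Fin 3) (Fin 3) ℝ).charpoly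
    = (X - C (a-c)) * ((X - C (a+c)) * (X - C d) - C (2*b^2)) := by
  rw [Matrix.charpoly, Matrix.det_fin_three]
  simp [Matrix.charmatrix_apply]
  have h2 : (C (2:ℝ)) = (2 : ℝ[X]) := rfl
  simp only [h2]
  ring

theorem bs_form (Q : Matrix (Fin 3) (Fin 3) ℝ) (h : IsBisymm Q) :
    Q = !![Q 0 0, Q 0 1, Q 0 2; Q 0 1, Q 1 1, Q 0 1; Q 0 2, Q 0 1, Q 0 0] := by
  obtain ⟨h1, h2⟩ := h
  have e1 : ∀ i j, Q j i = Q i j := fun i j => congrFun (congrFun h1 i) j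
  have e2 := fun i j => congrFun (congrFun h2 i) j
  have f1 := e2 0 0
  have f2 := e2 1 2
  simp [Matrix.mul_apply, Fin.sum_univ_three, revId] at f1 f2
  have g1 := e1 0 1
  have g2 := e1 0 2
  have g3 := e1 1 2
  ext i j
  fin_cases i <;> fin_cases j <;> simp <;> linarith

theorem bs_isBisymm (a b c d : ℝ) : IsBisymm !![a,b,c;b,d,b;c,b,a] := by
  constructor <;> ext i j <;> fin_cases i <;> fin_cases j <;>
    simp [Matrix.mul_apply, Fin.sum_univ_three, revId]

theorem bs_exists (α β γ a d : ℝ) (ha : 0 ≤ a) (hd : 0 ≤ d) (h1 : β ≤ a) (h2 : 2 * a ≤ α + β)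
    (h3 : β + γ ≤ 2 * a) (h4 : α + β + γ = d + 2 * a) :
    ∃ Q : Matrix (Fin 3) (Fin 3) ℝ, MatNonneg Q ∧ IsBisymm Q ∧
      Q.charpoly = (X - C α) * ((X - C β) * (X - C γ)) ∧
        Q 0 0 = a ∧ Q 1 1 = d ∧ Q 2 2 = a := by
  have hn : 0 ≤ (α + β - 2 * a) * (2 * a - β - γ) / 2 := by
    have := mul_nonneg (sub_nonneg.2 h2) (sub_nonneg.2 h3)
    linarith
  obtain ⟨b, hb, hb2⟩ : ∃ b : ℝ, 0 ≤ b ∧ b ^ 2 = (α + β - 2 * a) * (2 * a - β - γ) / 2 :=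
    ⟨_, Real.sqrt_nonneg _, Real.sq_sqrt hn⟩
  refine ⟨!![a,b,a-β;b,d,b;a-β,b,a], ?_, bs_isBisymm _ _ _ _, ?_, by simp, by simp, by simp⟩
  · intro i j
    fin_cases i <;> fin_cases j <;> simp <;> linarith
  · rw [bs_charpoly, hb2]
    apply Polynomial.funext
    intro x
    obtain rfl : d = α + β + γ - 2 * a := by linarith
    simp
    ring

/-- Lemma 5.1: for `α₀ ≥ α₁ ≥ α₂` and nonnegative `a₀, a₁`, there is a `3 × 3`
nonnegative bisymmetric matrix with eigenvalues `α₀, α₁, α₂` and diagonal `a₁, a₀, a₁`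
iff for some `j ∈ {1, 2}`: `a₁ ≥ αⱼ`, `α₀ + αⱼ ≥ 2a₁`, `α₁ + α₂ ≤ 2a₁` and
`α₀ + α₁ + α₂ = a₀ + 2a₁`. -/
theorem bniep_three_diag (α0 α1 α2 a0 a1 : ℝ)
    (h01 : α1 ≤ α0) (h12 : α2 ≤ α1) (ha0 : 0 ≤ a0) (ha1 : 0 ≤ a1) :
    (∃ Q : Matrix (Fin 3) (Fin 3) ℝ, MatNonneg Q ∧ IsBisymm Q ∧
        HasEigsM Q (α0 ::ₘ α1 ::ₘ {α2}) ∧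
        Q 0 0 = a1 ∧ Q 1 1 = a0 ∧ Q 2 2 = a1) ↔
      ((α1 ≤ a1 ∧ 2 * a1 ≤ α0 + α1 ∧ α1 + α2 ≤ 2 * a1 ∧ α0 + α1 + α2 = a0 + 2 * a1) ∨
       (α2 ≤ a1 ∧ 2 * a1 ≤ α0 + α2 ∧ α1 + α2 ≤ 2 * a1 ∧
         α0 + α1 + α2 = a0 + 2 * a1)) := by
  constructor
  · rintro ⟨Q, hQ, hb, he, rfl, rfl, h22⟩
    have hc := hQ 0 2
    have hf := bs_form Q hb
    unfold HasEigsM at he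
    rw [hf, bs_charpoly] at he
    generalize Q 0 0 = a at *
    generalize Q 0 1 = b at *
    generalize Q 0 2 = c at *
    generalize Q 1 1 = d at *
    have ev : ∀ x : ℝ, (x - (a-c)) * ((x-(a+c))*(x-d) - 2*b^2) =
        (x-α0)*((x-α1)*(x-α2)) := by
      intro x
      simpa using congrArg (Polynomial.eval x) he
    have p0 := ev 0
    have p1 := ev 1
    have p2 := ev (-1)
    have tr : α0 + α1 + α2 = d + 2 * a := by linarith
    have e2 : α0*α1+α0*α2+α1*α2 = (a-c)*(a+c+d) + (a+c)*d - 2*b^2 := by linarith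
    have r := ev (a-c)
    rw [sub_self, zero_mul] at r
    have hb2 := sq_nonneg b
    clear he p0 p1 p2 ev hf
    rcases mul_eq_zero.1 r.symm with h | h
    · obtain rfl : α0 = a - c := by linarith
      obtain rfl : d = α1 + α2 - a - c := by linarith
      have key : (α1-(a+c))*(a+c-α2) = 2*b^2 := by linarith
      have k : a + c ≤ α1 := by
        by_contra! hlt
        nlinarith
      left
      refine ⟨?_, ?_, ?_, ?_⟩ <;> linarith
    · rcases mul_eq_zero.1 h with h | h
      · obtain rfl : α1 = a - c := by linarith
        obtain rfl : d = α0 + α2 - a - c := by linarith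
        have key : (α0-(a+c))*(a+c-α2) = 2*b^2 := by linarith
        have k : a + c ≤ α0 := by
          by_contra! hlt
          nlinarith
        left
        refine ⟨?_, ?_, ?_, ?_⟩ <;> linarith
      · obtain rfl : α2 = a - c := by linarith
        obtain rfl : d = α0 + α1 - a - c := by linarith
        have key : (α0-(a+c))*(a+c-α1) = 2*b^2 := by linarith
        have k : a + c ≤ α0 := by
          by_contra! hlt
          nlinarith
        have k' : α1 ≤ a + c := by
          by_contra! hlt
          nlinarith
        right
        refine ⟨?_, ?_, ?_, ?_⟩ <;> linarith
  · rintro (⟨h1, h2, h3, h4⟩ | ⟨h1, h2, h3, h4⟩)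
    · obtain ⟨Q, q1, q2, q3, q4⟩ := bs_exists α0 α1 α2 a1 a0 ha1 ha0 h1 h2 h3 h4
      refine ⟨Q, q1, q2, ?_, q4⟩
      simp [HasEigsM, q3]
    · obtain ⟨Q, q1, q2, q3, q4⟩ := bs_exists α0 α2 α1 a1 a0 ha1 ha0 h1 h2
        (by linarith) (by linarith)
      refine ⟨Q, q1, q2, ?_, q4⟩
      simp [HasEigsM, q3, mul_comm]
end

section
/- Let λ0 ≥ λ1 ≥ ... ≥ λ_{2m} be real numbers and let a0, a1, ..., am be nonnegative real numbers satisfying: (1) for each k = 1, 2, ..., m there is j_k ∈ {2k−1, 2k} such that a_k ≥ λ_{j_k} and Σ_{i=0}^{2(k−1)} λ_i + λ_{j_k} ≥ 2·Σ_{i=1}^{k} a_i; (2) 2a_k ≥ λ_{2k−1} + λ_{2k} for each k = 1, 2, ..., m; and (3) Σ_{i=0}^{2m} λ_i = a0 + 2·Σ_{i=1}^{m} a_i. Then there exists a (2m+1)×(2m+1) nonnegative bisymmetric real matrix whose eigenvalues (with multiplicity) are λ0, λ1, ..., λ_{2m} and whose diagonal entries are, in order, a_m, a_{m−1}, ...,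 a1, a0, a1, ..., a_{m−1}, a_m. -/
open Matrix Polynomial BigOperators

/-- Givens rotation step: glue a new eigenvalue `x` onto `S` at index `0`. -/
lemma rot_step {n : ℕ} (S : Matrix (Fin (n+1)) (Fin (n+1)) ℝ) (x c s : ℝ)
    (hcs : c ^ 2 + s ^ 2 = 1) (hS : Sᵀ = S) :
    ∃ T : Matrix (Fin (n+1) ⊕ Fin 1) (Fin (n+1) ⊕ Fin 1) ℝ,
      Tᵀ = T ∧ T.charpoly = S.charpoly * (X - C x) ∧
      (∀ i j, i ≠ 0 → j ≠ 0 → T (.inl i) (.inl j) = S i j) ∧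
      (∀ i, i ≠ 0 → T (.inl i) (.inl 0) = c * S i 0) ∧
      (∀ i, i ≠ 0 → T (.inl i) (.inr 0) = s * S i 0) ∧
      T (.inl 0) (.inl 0) = c ^ 2 * S 0 0 + s ^ 2 * x ∧
      T (.inr 0) (.inr 0) = s ^ 2 * S 0 0 + c ^ 2 * x ∧
      T (.inl 0) (.inr 0) = c * s * (S 0 0 - x) := by
  let N : Matrix (Fin (n+1) ⊕ Fin 1) (Fin (n+1) ⊕ Fin 1) ℝ :=
    fromBlocks S 0 0 (diagonal fun _ => x)
  let G : Matrix (Fin (n+1) ⊕ Fin 1) (Fin (n+1) ⊕ Fin 1) ℝ := fun i =>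
    match i with
    | .inl i => if i = 0 then c • Pi.single (.inl 0) 1 - s • Pi.single (.inr 0) 1
        else Pi.single (.inl i) 1
    | .inr _ => s • Pi.single (.inl 0) 1 + c • Pi.single (.inr 0) 1
  have g0 : G (.inl 0) = c • Pi.single (.inl 0) 1 - s • Pi.single (.inr 0) 1 := by simp [G]
  have g1 : ∀ i, i ≠ 0 → G (.inl i) = Pi.single (.inl i) 1 := by intro i hi; simp [G, hi]
  have g2 : G (.inr 0) = s • Pi.single (.inl 0) 1 + c • Pi.single (.inr 0) 1 := by simp [G]
  have hsym : ∀ i j, S i j = S j i := fun i j => by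
    conv_lhs => rw [← hS]
    rfl
  have hN : Nᵀ = N := by simp [N, fromBlocks_transpose, hS]
  have hG : G * Gᵀ = 1 := by
    ext i j
    have : (G * Gᵀ) i j = G i ⬝ᵥ G j := by simp [Matrix.mul_apply, dotProduct]
    rw [this]
    rcases i with i | i <;> rcases j with j | j
    · by_cases hi : i = 0 <;> by_cases hj : j = 0
      · subst hi hj; rw [g0]; simp; linear_combination hcs
      · subst hi; rw [g0, g1 j hj]; simp [Matrix.one_apply, hj, Ne.symm hj]
      · subst hj; rw [g0, g1 i hi]; simp [Matrix.one_apply, hi, Ne.symm hi]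
      · rw [g1 i hi, g1 j hj]; simp [Matrix.one_apply, Pi.single_apply, eq_comm]
    · obtain rfl : j = 0 := Subsingleton.elim _ _
      by_cases hi : i = 0
      · subst hi; rw [g0, g2]; simp; ring
      · rw [g1 i hi, g2]; simp [hi, Ne.symm hi]
    · obtain rfl : i = 0 := Subsingleton.elim _ _
      by_cases hi : j = 0
      · subst hi; rw [g0, g2]; simp; ring
      · rw [g1 j hi, g2]; simp [hi, Ne.symm hi]
    · obtain rfl : i = 0 := Subsingleton.elim _ _
      obtain rfl : j = 0 := Subsingleton.elim _ _
      rw [g2]; simp; linear_combination hcs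
  have hG' : Gᵀ * G = 1 := mul_eq_one_comm.mp hG
  have hT : ∀ i j, (G * N * Gᵀ) i j = (G i ᵥ* N) ⬝ᵥ G j := by
    intro i j
    simp [Matrix.mul_apply, dotProduct, vecMul]
  refine ⟨G * N * Gᵀ, ?_, ?_, ?_, ?_, ?_, ?_, ?_, ?_⟩
  · rw [transpose_mul, transpose_mul, transpose_transpose, hN, Matrix.mul_assoc]
  · rw [Matrix.charpoly_mul_comm, ← Matrix.mul_assoc, hG', Matrix.one_mul]
    simp [N, Matrix.charpoly_fromBlocks_zero₂₁, Matrix.charpoly_diagonal]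
  · intro i j hi hj
    rw [hT, g1 i hi, g1 j hj]; simp [N]
  · intro i hi
    rw [hT, g1 i hi, g0]; simp [N]
  · intro i hi
    rw [hT, g1 i hi, g2]; simp [N]
  · rw [hT, g0]; simp [N, sub_vecMul, smul_vecMul]; ring
  · rw [hT, g2]; simp [N, add_vecMul, smul_vecMul]; ring
  · rw [hT, g2, g0]; simp [N, sub_vecMul, smul_vecMul]; ring

lemma exists_cs (x r b : ℝ) (h1 : x ≤ b) (h2 : b ≤ r) :
    ∃ c s : ℝ, 0 ≤ c ∧ 0 ≤ s ∧ c ^ 2 + s ^ 2 = 1 ∧ s ^ 2 * r + c ^ 2 * x = b := by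
  rcases eq_or_lt_of_le (h1.trans h2) with h | h
  · exact ⟨1, 0, by norm_num, le_rfl, by norm_num, by linarith⟩
  · have hp : 0 < r - x := by linarith
    refine ⟨√((r - b) / (r - x)), √((b - x) / (r - x)), by positivity, by positivity, ?_, ?_⟩
    · rw [Real.sq_sqrt (div_nonneg (by linarith) hp.le),
        Real.sq_sqrt (div_nonneg (by linarith) hp.le)]
      field_simp; ring
    · rw [Real.sq_sqrt (div_nonneg (by linarith) hp.le),
        Real.sq_sqrt (div_nonneg (by linarith) hp.le)]
      field_simp; ring

/-- Fiedler-type lemma: a symmetric matrix with nonnegative off-diagonal entries with prescribed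
eigenvalues and diagonal. -/
lemma fiedler (m : ℕ) (μ b : ℕ → ℝ) (h1 : ∀ k, 1 ≤ k → k ≤ m → μ k ≤ b k)
    (h2 : ∀ k, 1 ≤ k → k ≤ m → ∑ i ∈ Finset.Icc 1 k, b i ≤ ∑ i ∈ Finset.range k, μ i) :
    ∃ S : Matrix (Fin (m+1)) (Fin (m+1)) ℝ, Sᵀ = S ∧
      S.charpoly = ∏ i ∈ Finset.range (m+1), (X - C (μ i)) ∧
      (∀ i j, i ≠ j → 0 ≤ S i j) ∧ (∀ i : Fin (m+1), i ≠ 0 → S i i = b i) ∧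
      S 0 0 = ∑ i ∈ Finset.range (m+1), μ i - ∑ i ∈ Finset.Icc 1 m, b i := by
  induction m with
  | zero =>
    refine ⟨diagonal fun _ => μ 0, by simp, by simp [Matrix.charpoly_diagonal], ?_, ?_, by simp⟩
    · intro i j h; exact absurd (Fin.ext (by omega)) h
    · intro i h; exact absurd (Fin.ext (by simp)) h
  | succ m ih =>
    obtain ⟨S, hS, hch, hoff, hdiag, h00⟩ := ih (fun k a b => h1 k a (by omega))
      (fun k a b => h2 k a (by omega))
    have hsum := h2 (m+1) (by omega) le_rfl
    have hx := h1 (m+1) (by omega) le_rfl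
    rw [Finset.sum_Icc_succ_top (by omega)] at hsum
    have hbr : b (m+1) ≤ S 0 0 := by rw [h00]; linarith
    obtain ⟨c, s, hc, hs, hcs, hb⟩ := exists_cs _ _ _ hx hbr
    obtain ⟨T, hT, Tch, t1, t2, t3, t4, t5, t6⟩ := rot_step S (μ (m+1)) c s hcs hS
    have hsym : ∀ i j, T i j = T j i := fun i j => by
      conv_lhs => rw [← hT]
      rfl
    let e : Fin (m+1) ⊕ Fin 1 ≃ Fin (m+1+1) := finSumFinEquiv
    have e0 : e (.inl 0) = 0 := rfl
    have hToff : ∀ i j, i ≠ j → 0 ≤ T i j := by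
      rintro (i | i) (j | j) hij
      · by_cases hi : i = 0 <;> by_cases hj : j = 0
        · subst hi hj; exact absurd rfl hij
        · subst hi; rw [hsym, t2 j hj]; exact mul_nonneg hc (hoff _ _ hj)
        · subst hj; rw [t2 i hi]; exact mul_nonneg hc (hoff _ _ hi)
        · rw [t1 i j hi hj]; exact hoff _ _ (fun h => hij (by rw [h]))
      · obtain rfl : j = 0 := Subsingleton.elim _ _
        by_cases hi : i = 0
        · subst hi; rw [t6]; exact mul_nonneg (mul_nonneg hc hs) (by linarith)
        · rw [t3 i hi]; exact mul_nonneg hs (hoff _ _ hi)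
      · obtain rfl : i = 0 := Subsingleton.elim _ _
        rw [hsym]
        by_cases hi : j = 0
        · subst hi; rw [t6]; exact mul_nonneg (mul_nonneg hc hs) (by linarith)
        · rw [t3 j hi]; exact mul_nonneg hs (hoff _ _ hi)
      · exact absurd (congrArg Sum.inr (Subsingleton.elim i j)) hij
    refine ⟨reindex e e T, ?_, ?_, ?_, ?_, ?_⟩
    · rw [transpose_reindex, hT]
    · rw [Matrix.charpoly_reindex, Tch, hch, Finset.prod_range_succ _ (m+1)]
    · intro i j hij
      exact hToff _ _ (fun h => hij (e.symm.injective h))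
    · intro i hi
      obtain ⟨i, rfl⟩ := e.surjective i
      simp only [reindex_apply, submatrix_apply, Equiv.symm_apply_apply]
      rcases i with i | i
      · have hi' : i ≠ 0 := by rintro rfl; exact hi e0
        rw [t1 i i hi' hi', hdiag i hi']
        rfl
      · obtain rfl : i = 0 := Subsingleton.elim _ _
        rw [t5, hb]
        rfl
    · rw [← e0]
      simp only [reindex_apply, submatrix_apply, Equiv.symm_apply_apply]
      rw [t4, Finset.sum_range_succ, Finset.sum_Icc_succ_top (by omega)]
      linear_combination (S 0 0 + μ (m+1)) * hcs + h00 - hb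

/-- Assembling a bisymmetric matrix from its symmetric and antisymmetric parts. -/
lemma assemble (m : ℕ) (S : Matrix (Fin (m+1)) (Fin (m+1)) ℝ) (d a : ℕ → ℝ) (hS : Sᵀ = S)
    (hoff : ∀ i j, i ≠ j → 0 ≤ S i j) (h00 : S 0 0 = a 0)
    (hdiag : ∀ i : Fin (m+1), i ≠ 0 → S i i = 2 * a i - d i)
    (ha : ∀ i, i ≤ m → 0 ≤ a i) (hd : ∀ k, 1 ≤ k → k ≤ m → d k ≤ a k) :
    ∃ Q : Matrix (Fin (2 * m + 1)) (Fin (2 * m + 1)) ℝ,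
      MatNonneg Q ∧ IsBisymm Q ∧
      Q.charpoly = S.charpoly * ∏ k : Fin m, (X - C (d (k + 1))) ∧
        ∀ i : Fin (2 * m + 1), Q i i = a ((m : ℤ) - (i : ℕ)).natAbs := by
  let t : Fin (2*m+1) → ℕ := fun i => ((m : ℤ) - (i : ℕ)).natAbs
  have htm : ∀ i, t i ≤ m := fun i => by have := i.2; simp only [t]; omega
  let p : Fin (2*m+1) → Fin (m+1) := fun i => ⟨t i, by have := htm i; omega⟩
  let α : Fin (2*m+1) → ℝ := fun i => if t i = 0 then 1 else (√2)⁻¹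
  let σ : Fin (2*m+1) → ℝ := fun i => if (i : ℕ) < m then (√2)⁻¹ else -(√2)⁻¹
  let β : Fin (2*m+1) → Fin m → ℝ := fun i k => if t i = k + 1 then σ i else 0
  have h2 : (√2)⁻¹ * (√2)⁻¹ = (1 / 2 : ℝ) := by
    rw [← mul_inv, Real.mul_self_sqrt (by norm_num)]; norm_num
  have hα0 : ∀ i, 0 ≤ α i := fun i => by simp only [α]; split_ifs <;> positivity
  -- the two bilinear sums
  have hβ : ∀ (f : ℕ → ℝ) i j, ∑ k : Fin m, β i k * f (k+1) * β j k =
      if t i = t j ∧ t i ≠ 0 then σ i * σ j * f (t i) else 0 := by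
    intro f i j
    by_cases h0 : t i = 0
    · simp [β, h0]
    · have hlt : t i - 1 < m := by have := htm i; omega
      rw [Finset.sum_eq_single ⟨t i - 1, hlt⟩]
      · have e1 : t i - 1 + 1 = t i := by omega
        simp only [β, e1, if_true]
        by_cases h : t i = t j
        · rw [if_pos h.symm, if_pos ⟨h, h0⟩]; ring
        · simp [h, Ne.symm h]
      · intro k _ hk
        have : t i ≠ k + 1 := fun h => hk (Fin.ext (by simp [h]))
        simp [β, this]
      · simp
  have hσ : ∀ i j, t i = t j → t i ≠ 0 → σ i * σ j = if i = j then 1/2 else -(1/2) := by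
    intro i j h h0
    simp only [t] at h h0
    by_cases hij : i = j
    · subst hij; simp only [σ]; split_ifs <;> simp [h2]
    · have hij' : (i:ℕ) ≠ j := fun h => hij (Fin.ext h)
      simp only [σ, hij, if_false]
      split_ifs
      · omega
      · linarith
      · linarith
      · omega
  let U : Matrix (Fin (2*m+1)) (Fin (m+1) ⊕ Fin m) ℝ := fun i =>
    Sum.elim (fun j => if p i = j then α i else 0) (β i)
  let N : Matrix (Fin (m+1) ⊕ Fin m) (Fin (m+1) ⊕ Fin m) ℝ :=
    fromBlocks S 0 0 (diagonal fun k => d (k+1))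
  have uL : ∀ i j, U i (.inl j) = if p i = j then α i else 0 := fun _ _ => rfl
  have uR : ∀ i k, U i (.inr k) = β i k := fun _ _ => rfl
  have hN : Nᵀ = N := by simp [N, fromBlocks_transpose, hS]
  have hp : ∀ i j, p i = p j ↔ t i = t j := fun i j => by simp [p]
  have hα : ∀ i j, t i = t j → α i * α j = if t i = 0 then 1 else 1/2 := by
    intro i j h
    simp only [α, ← h]; split_ifs <;> simp [h2]
  have hU : U * Uᵀ = 1 := by
    ext i j
    have := hβ (fun _ => 1) i j
    simp only [mul_one] at this
    rw [Matrix.mul_apply, Fintype.sum_sum_type]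
    simp only [transpose_apply, uL, uR, this]
    simp only [ite_mul, zero_mul, Finset.sum_ite_eq, Finset.mem_univ, if_true]
    by_cases h : t i = t j
    · rw [if_pos ((hp j i).2 h.symm), hα i j h]
      by_cases h0 : t i = 0
      · have : i = j := by
          apply Fin.ext; simp only [t] at h h0; omega
        subst this
        simp [h0]
      · rw [if_neg h0, if_pos ⟨h, h0⟩, hσ i j h h0, Matrix.one_apply]
        split_ifs <;> norm_num
    · have hij : i ≠ j := fun e => h (by rw [e])
      have hpij : ¬ p j = p i := fun e => h ((hp j i).1 e).symm
      simp [h, hij, hpij]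
  have hU' : Uᵀ * U = 1 := by
    refine (Matrix.mul_eq_one_comm_of_card_eq _ _ _ ?_).1 hU
    simp; omega
  have hQ : ∀ i j, (U * N * Uᵀ) i j = α i * α j * S (p i) (p j) +
      if t i = t j ∧ t i ≠ 0 then σ i * σ j * d (t i) else 0 := by
    intro i j
    rw [← hβ d i j, Matrix.mul_apply, Fintype.sum_sum_type]
    congr 1
    · simp [uL, uR, N, Matrix.mul_apply, Fintype.sum_sum_type]
      ring
    · apply Finset.sum_congr rfl
      intro k _
      simp [uL, uR, N, Matrix.mul_apply, Fintype.sum_sum_type, diagonal_apply]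
  have hQd : ∀ i, (U * N * Uᵀ) i i = a (t i) := by
    intro i
    rw [hQ, hα i i rfl]
    by_cases h0 : t i = 0
    · have : p i = 0 := Fin.ext h0
      simp [h0, this, h00]
    · have : p i ≠ 0 := fun e => h0 (congrArg Fin.val e)
      rw [if_neg h0, if_pos ⟨rfl, h0⟩, hσ i i rfl h0, hdiag _ this, if_pos rfl]
      simp only [p]; ring
  refine ⟨U * N * Uᵀ, ?_, ⟨?_, ?_⟩, ?_, hQd⟩
  · intro i j
    by_cases hij : i = j
    · subst hij; rw [hQd]; exact ha _ (htm i)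
    · rw [hQ]
      by_cases h : t i = t j
      · have h0 : t i ≠ 0 := by
          intro h0; apply hij; apply Fin.ext; simp only [t] at h h0; omega
        have : p i ≠ 0 := fun e => h0 (congrArg Fin.val e)
        rw [if_pos ⟨h, h0⟩, hσ i j h h0, if_neg hij, hα i j h, if_neg h0, ← (hp i j).2 h,
          hdiag _ this]
        have := hd (t i) (by omega) (htm i)
        simp only [p]; linarith
      · rw [if_neg (fun e => h e.1), add_zero]
        exact mul_nonneg (mul_nonneg (hα0 i) (hα0 j)) (hoff _ _ (fun e => h ((hp i j).1 e)))
  · rw [transpose_mul, transpose_mul, transpose_transpose, hN, Matrix.mul_assoc]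
  · have hrev : revId (2*m+1) = (1 : Matrix (Fin (2*m+1)) (Fin (2*m+1)) ℝ).submatrix Fin.rev id := by
      ext i j
      simp only [revId, Matrix.of_apply, submatrix_apply, Matrix.one_apply, Fin.ext_iff,
        Fin.val_rev, id]
      congr 1
      apply propext; omega
    have htr : ∀ i, t i.rev = t i := fun i => by
      simp only [t, Fin.val_rev]; omega
    have hpr : ∀ i, p i.rev = p i := fun i => (hp _ _).2 (htr i)
    have hαr : ∀ i, α i.rev = α i := fun i => by simp only [α, htr]
    have key : ∀ i j, (U * N * Uᵀ) i.rev j.rev = (U * N * Uᵀ) i j := by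
      intro i j
      rw [hQ, hQ, htr, htr, hpr, hpr, hαr, hαr]
      congr 1
      by_cases h : t i = t j ∧ t i ≠ 0
      · rw [if_pos h, if_pos h, hσ i j h.1 h.2, hσ i.rev j.rev (by rw [htr, htr, h.1])
          (by rw [htr]; exact h.2)]
        simp
      · rw [if_neg h, if_neg h]
    ext i j
    rw [← key i j, hrev, Matrix.mul_apply]
    generalize U * N * Uᵀ = Q
    have : ∀ k, ((1 : Matrix (Fin (2*m+1)) (Fin (2*m+1)) ℝ).submatrix Fin.rev id * Q) i k = Q i.rev k := by
      intro k; simp [Matrix.mul_apply, Matrix.one_apply]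
    simp only [this]
    rw [Finset.sum_eq_single j.rev]
    · rw [submatrix_apply, Fin.rev_rev, id, Matrix.one_apply_eq, mul_one]
    · intro k _ hk
      have : k.rev ≠ j := fun e => hk (by rw [← e, Fin.rev_rev])
      simp [this]
    · simp
  · have h := Matrix.charpoly_mul_comm' (U * N) Uᵀ
    have hc : Fintype.card (Fin (m+1) ⊕ Fin m) = Fintype.card (Fin (2*m+1)) := by
      simp; omega
    rw [hc] at h
    have h' := mul_left_cancel₀ (pow_ne_zero _ X_ne_zero) h
    rw [h', ← Matrix.mul_assoc, hU', Matrix.one_mul]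
    simp [N, Matrix.charpoly_fromBlocks_zero₂₁, Matrix.charpoly_diagonal]

/-- Theorem 5.2: BNIEP with prescribed diagonal, odd size. Under conditions (1)–(3)
there is a `(2m+1) × (2m+1)` nonnegative bisymmetric matrix with eigenvalues
`λ₀, …, λ_{2m}` and diagonal `a_m, a_{m-1}, …, a₁, a₀, a₁, …, a_{m-1}, a_m`. -/
theorem bniep_diag_odd (m : ℕ) (lam : ℕ → ℝ) (a : ℕ → ℝ)
    (hanti : ∀ i j, i ≤ j → j ≤ 2 * m → lam j ≤ lam i)
    (hann : ∀ i, i ≤ m → 0 ≤ a i)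
    (h1 : ∀ k, 1 ≤ k → k ≤ m → ∃ jk, (jk = 2 * k - 1 ∨ jk = 2 * k) ∧
        lam jk ≤ a k ∧
        2 * (∑ i ∈ Finset.Icc 1 k, a i) ≤
          (∑ i ∈ Finset.range (2 * (k - 1) + 1), lam i) + lam jk)
    (h2 : ∀ k, 1 ≤ k → k ≤ m → lam (2 * k - 1) + lam (2 * k) ≤ 2 * a k)
    (h3 : ∑ i ∈ Finset.range (2 * m + 1), lam i
        = a 0 + 2 * ∑ i ∈ Finset.Icc 1 m, a i) :
    ∃ Q : Matrix (Fin (2 * m + 1)) (Fin (2 * m + 1)) ℝ,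
      MatNonneg Q ∧ IsBisymm Q ∧ (HasEigs Q fun i => lam (i : ℕ)) ∧
        ∀ i : Fin (2 * m + 1), Q i i = a ((m : ℤ) - (i : ℕ)).natAbs := by
  choose! j hj hja hjs using h1
  let μ : ℕ → ℝ := fun k => if k = 0 then lam 0 else lam (4 * k - 1 - j k)
  let d : ℕ → ℝ := fun k => lam (j k)
  have pair : ∀ k, k + 1 ≤ m → (μ (k+1) = lam (2*k+1) ∧ d (k+1) = lam (2*k+2)) ∨
      (μ (k+1) = lam (2*k+2) ∧ d (k+1) = lam (2*k+1)) := by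
    intro k hk
    rcases hj (k+1) (by omega) hk with h | h
    · right
      simp only [μ, d, h]
      constructor
      · rw [if_neg (by omega)]; congr 1; omega
      · congr 1
    · left
      simp only [μ, d, h]
      constructor
      · rw [if_neg (by omega)]; congr 1; omega
      · congr 1
  have hsum : ∀ k, k ≤ m → ∑ i ∈ Finset.range (2*k+1), lam i =
      ∑ i ∈ Finset.range (k+1), μ i + ∑ i ∈ Finset.Icc 1 k, d i := by
    intro k
    induction k with
    | zero => intro _; simp [μ]
    | succ k ih =>
      intro hk
      rw [show 2*(k+1)+1 = 2*k+1+1+1 by ring, Finset.sum_range_succ, Finset.sum_range_succ,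
        ih (by omega), Finset.sum_range_succ _ (k+1), Finset.sum_Icc_succ_top (by omega)]
      rcases pair k hk with ⟨h, h'⟩ | ⟨h, h'⟩ <;> rw [h, h'] <;> ring
  have hprod : ∀ k, k ≤ m → ∏ i ∈ Finset.range (2*k+1), (X - C (lam i)) =
      (∏ i ∈ Finset.range (k+1), (X - C (μ i))) * ∏ i ∈ Finset.range k, (X - C (d (i+1))) := by
    intro k
    induction k with
    | zero => intro _; simp [μ]
    | succ k ih =>
      intro hk
      rw [show 2*(k+1)+1 = 2*k+1+1+1 by ring, Finset.prod_range_succ, Finset.prod_range_succ,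
        ih (by omega), Finset.prod_range_succ _ (k+1),
        Finset.prod_range_succ (fun i => X - C (d (i+1))) k]
      rcases pair k hk with ⟨h, h'⟩ | ⟨h, h'⟩ <;> rw [h, h'] <;> ring
  obtain ⟨S, hS, hch, hoff, hdiag, h00⟩ := fiedler m μ (fun k => 2 * a k - d k)
    (by
      intro k hk hkm
      have := h2 k hk hkm
      obtain ⟨k, rfl⟩ : ∃ k', k = k' + 1 := ⟨k - 1, by omega⟩
      rw [show 2*(k+1)-1 = 2*k+1 by omega, show 2*(k+1) = 2*k+2 by ring] at this
      rcases pair k hkm with ⟨h, h'⟩ | ⟨h, h'⟩ <;> simp only [h, h'] <;> linarith)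
    (by
      intro k hk hkm
      have := hjs k hk hkm
      obtain ⟨k, rfl⟩ : ∃ k', k = k' + 1 := ⟨k - 1, by omega⟩
      rw [Nat.add_sub_cancel, hsum k (by omega)] at this
      rw [Finset.sum_sub_distrib, ← Finset.mul_sum, Finset.sum_Icc_succ_top (by omega) d]
      simp only [d] at this ⊢
      linarith)
  obtain ⟨Q, q1, q2, q3, q4⟩ := assemble m S d a hS hoff
    (by
      rw [h00, Finset.sum_sub_distrib, ← Finset.mul_sum]
      have := hsum m le_rfl
      linarith) hdiag hann hja
  refine ⟨Q, q1, q2, ?_, q4⟩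
  unfold HasEigs
  rw [q3, hch, Fin.prod_univ_eq_prod_range (fun i => (X - C (lam i))) (2*m+1), hprod m le_rfl,
    Fin.prod_univ_eq_prod_range (fun i => (X - C (d (i+1)))) m]
end
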